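/- arXiv:2601.02682 — 10 statements merged into one kernel-verified Lean document; each statement's English description precedes it below -/
import Mathlib

section
/- Let D, R, K be positive integers, L > 0, ξ ≥ 0, ρ ≥ 0, and for each w ∈ {1,…,R} let f_w : ℝ^D → ℝ be differentiable with L-Lipschitz gradient. Set f = (1/R)·Σ_{w=1}^R f_w and assume f(x) ≥ f* for all x and sup_x max_w ‖∇f_w(x) − ∇f(x)‖ ≤ ξ. Let M ∈ ℝ^{R×R} be row-stochastic with a Perron vector p, let λ = max_w Σ_v |M_{wv} − p_v| and β = Σ_v |p_v − 1/R|, and assume λ < 1, ρ < (1−λ)/4, and K ≥ max{16(λ+4ρ)²L²/(1−λ−4ρ)², L²}. Set γ = 1/√K and let iterates x_w^k ∈ ℝ^D satisfy: x_w^0 = x^0 for all w; the half-step x_w^{k+½} = x_w^k − γ∇f_w(x_w^k); and for every w and k, ‖x_w^{k+1} − Σ_v M_{wv} x_v^{k+½}‖ ≤ ρ · max_{v∈{1,…,R}} ‖x_v^{k+½} − Σ_u M_{wu} x_u^{k+½}‖. Then, with x̄^k = (1/R)Σ_w x_w^k, the averaged squared gradient norm satisfies (1/K)·Σ_{k=0}^{K−1}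 ‖∇f(x̄^k)‖² ≤ 4(f(x^0) − f*)/√K + 1024(1+ρ)²L²(λ+4ρ)²ξ²/(K(1−λ−4ρ)²) + 256ρ²ξ²/(1−λ−4ρ)² + 4β²ξ². -/
open Finset

/-- Descent lemma for a function with `L`-Lipschitz gradient. -/
theorem le_add_inner_gradient_add_sq_of_lipschitz_gradient
    {E : Type*} [NormedAddCommGroup E] [InnerProductSpace ℝ E] [CompleteSpace E]
    {F : E → ℝ} {L : ℝ} (hF : Differentiable ℝ F)
    (hL : ∀ x y, ‖gradient F x - gradient F y‖ ≤ L * ‖x - y‖) (x d : E) :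
    F (x + d) ≤ F x + inner ℝ (gradient F x) d + L / 2 * ‖d‖ ^ 2 := by
  set g : ℝ → ℝ := fun t =>
    F (x + t • d) - t * inner ℝ (gradient F x) d - L / 2 * ‖d‖ ^ 2 * t ^ 2 with hg
  have hder : ∀ t, HasDerivAt g (inner ℝ (gradient F (x + t • d)) d
      - inner ℝ (gradient F x) d - L * ‖d‖ ^ 2 * t) t := by
    intro t
    have hline : HasDerivAt (fun s : ℝ => x + s • d) d t := by
      simpa using ((hasDerivAt_id t).smul_const d).const_add x
    have hcomp : HasDerivAt (fun s : ℝ => F (x + s • d))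
        (inner ℝ (gradient F (x + t • d)) d) t := by
      have h := (hF (x + t • d)).hasGradientAt.hasFDerivAt.comp_hasDerivAt t hline
      simpa [Function.comp_def] using h
    have hlin := (hasDerivAt_id t).mul_const (inner ℝ (gradient F x) d)
    have hsq := ((hasDerivAt_id t).pow 2).const_mul (L / 2 * ‖d‖ ^ 2)
    refine ((hcomp.sub hlin).sub hsq).congr_deriv ?_
    simp
    ring
  have hanti : AntitoneOn g (Set.Ici 0) := by
    refine antitoneOn_of_deriv_nonpos (convex_Ici 0)
      (fun t _ => (hder t).continuousAt.continuousWithinAt)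
      (fun t _ => (hder t).differentiableAt.differentiableWithinAt) fun t ht => ?_
    rw [interior_Ici, Set.mem_Ioi] at ht
    rw [(hder t).deriv, ← inner_sub_left]
    have hlip := hL (x + t • d) x
    rw [add_sub_cancel_left, norm_smul, Real.norm_of_nonneg ht.le] at hlip
    have hcs := real_inner_le_norm (gradient F (x + t • d) - gradient F x) d
    have := mul_le_mul_of_nonneg_right hlip (norm_nonneg d)
    linarith
  have h01 := hanti (Set.mem_Ici.2 le_rfl) (Set.mem_Ici.2 zero_le_one) zero_le_one
  simp only [hg, one_smul, zero_smul, add_zero] at h01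
  linarith

/-- One inexact gradient step with step size `γ ≤ 1 / L`. -/
theorem inexact_gradient_step_le
    {E : Type*} [NormedAddCommGroup E] [InnerProductSpace ℝ E] [CompleteSpace E]
    {F : E → ℝ} {L γ : ℝ} (hF : Differentiable ℝ F)
    (hL : ∀ x y, ‖gradient F x - gradient F y‖ ≤ L * ‖x - y‖)
    (hγ : 0 ≤ γ) (hγL : γ * L ≤ 1) (x G : E) :
    F (x - γ • G) ≤ F x - γ / 2 * ‖gradient F x‖ ^ 2 + γ / 2 * ‖G - gradient F x‖ ^ 2 := by
  have h := le_add_inner_gradient_add_sq_of_lipschitz_gradient hF hL x (-(γ • G))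
  rw [← sub_eq_add_neg, norm_neg, norm_smul, inner_neg_right, inner_smul_right,
    Real.norm_of_nonneg hγ] at h
  rw [norm_sub_sq_real, real_inner_comm]
  have := mul_le_mul_of_nonneg_right hγL (mul_nonneg hγ (sq_nonneg ‖G‖))
  linarith

/-- A convex combination of points within distance `C` of `z` is within distance `C` of `z`. -/
theorem norm_sum_smul_sub_le_of_convex_weights
    {ι E : Type*} [Fintype ι] [NormedAddCommGroup E] [NormedSpace ℝ E]
    {q : ι → ℝ} (hq0 : ∀ i, 0 ≤ q i) (hq1 : ∑ i, q i = 1) {y : ι → E} {z : E} {C : ℝ}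
    (hy : ∀ i, ‖y i - z‖ ≤ C) : ‖∑ i, q i • y i - z‖ ≤ C := by
  have h := (convex_closedBall z C).sum_mem (t := Finset.univ) (w := q) (z := y)
    (fun i _ => hq0 i) hq1 fun i _ => by simpa [dist_eq_norm] using hy i
  simpa [dist_eq_norm] using h

/-- A convex combination of vectors of norm at most `C` has norm at most `C`. -/
theorem norm_sum_smul_le_of_convex_weights
    {ι E : Type*} [Fintype ι] [NormedAddCommGroup E] [NormedSpace ℝ E]
    {q : ι → ℝ} (hq0 : ∀ i, 0 ≤ q i) (hq1 : ∑ i, q i = 1) {y : ι → E} {C : ℝ}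
    (hy : ∀ i, ‖y i‖ ≤ C) : ‖∑ i, q i • y i‖ ≤ C := by
  have h := norm_sum_smul_sub_le_of_convex_weights hq0 hq1 (y := y) (z := 0) (C := C)
  simp only [sub_zero] at h
  exact h hy

/-- Two weighted averages of points with pairwise distances at most `C` differ by at most `C`
times the total variation distance of the weights. -/
theorem norm_sum_smul_sub_sum_smul_le_total_variation
    {ι E : Type*} [Fintype ι] [NormedAddCommGroup E] [NormedSpace ℝ E]
    {q r : ι → ℝ} (hqr : ∑ i, q i = ∑ i, r i) {y : ι → E} {C : ℝ}
    (hy : ∀ i j, ‖y i - y j‖ ≤ C) :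
    ‖∑ i, q i • y i - ∑ i, r i • y i‖ ≤ (∑ i, |q i - r i|) / 2 * C := by
  set P := ∑ i, (q i - r i)⁺ with hP
  have hdiff : P - ∑ i, (q i - r i)⁻ = 0 := by
    rw [hP, ← Finset.sum_sub_distrib]
    simp [hqr]
  have hneg : ∑ i, (q i - r i)⁻ = P := by linarith
  have habs : (∑ i, |q i - r i|) / 2 = P := by
    have : ∑ i, |q i - r i| = P + ∑ i, (q i - r i)⁻ := by
      rw [hP, ← Finset.sum_add_distrib]
      simp [posPart_add_negPart]
    linarith
  have hP0 : 0 ≤ P := Finset.sum_nonneg fun i _ => posPart_nonneg _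
  have hsum : ∑ i, q i • y i - ∑ i, r i • y i
      = ∑ i, (q i - r i)⁺ • y i - ∑ i, (q i - r i)⁻ • y i := by
    rw [← Finset.sum_sub_distrib, ← Finset.sum_sub_distrib]
    simp only [← sub_smul, posPart_sub_negPart]
  have hdouble : P • (∑ i, (q i - r i)⁺ • y i - ∑ j, (q j - r j)⁻ • y j)
      = ∑ i, ∑ j, ((q i - r i)⁺ * (q j - r j)⁻) • (y i - y j) := by
    simp only [smul_sub, Finset.sum_sub_distrib]
    congr 1
    · simp only [← Finset.sum_smul, ← Finset.mul_sum, hneg, Finset.smul_sum, smul_smul,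
        mul_comm P]
    · rw [Finset.sum_comm]
      simp only [← Finset.sum_smul, ← Finset.sum_mul, ← hP, Finset.smul_sum, smul_smul]
  have hbound : P * ‖∑ i, q i • y i - ∑ i, r i • y i‖ ≤ P * (P * C) := by
    calc P * ‖∑ i, q i • y i - ∑ i, r i • y i‖
        = ‖∑ i, ∑ j, ((q i - r i)⁺ * (q j - r j)⁻) • (y i - y j)‖ := by
          rw [← hdouble, ← hsum, norm_smul, Real.norm_of_nonneg hP0]
      _ ≤ ∑ i, ∑ j, ((q i - r i)⁺ * (q j - r j)⁻) * C := by
          refine norm_sum_le_of_le _ fun i _ => norm_sum_le_of_le _ fun j _ => ?_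
          have h0 : 0 ≤ (q i - r i)⁺ * (q j - r j)⁻ :=
            mul_nonneg (posPart_nonneg _) (negPart_nonneg _)
          rw [norm_smul, Real.norm_of_nonneg h0]
          exact mul_le_mul_of_nonneg_left (hy i j) h0
      _ = P * (P * C) := by
          simp only [← Finset.sum_mul, ← Finset.mul_sum, hneg, ← hP]
          ring
  rw [habs]
  rcases hP0.eq_or_lt with h | h
  · have hz : ∀ i, (q i - r i)⁺ = 0 := fun i =>
      (Finset.sum_eq_zero_iff_of_nonneg fun i _ => posPart_nonneg (q i - r i)).1 h.symm i
        (Finset.mem_univ i)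
    have hz' : ∀ i, (q i - r i)⁻ = 0 := fun i =>
      (Finset.sum_eq_zero_iff_of_nonneg fun i _ => negPart_nonneg (q i - r i)).1
        (hneg.trans h.symm) i (Finset.mem_univ i)
    rw [hsum]
    simp [hz, hz', ← h]
  · exact le_of_mul_le_mul_left hbound h

/-- The gradient of a scaled sum is the scaled sum of the gradients. -/
theorem hasGradientAt_const_mul_sum
    {ι E : Type*} [Fintype ι] [NormedAddCommGroup E] [InnerProductSpace ℝ E] [CompleteSpace E]
    {f : ι → E → ℝ} (hf : ∀ i, Differentiable ℝ (f i)) (c : ℝ) (x : E) :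
    HasGradientAt (fun y => c * ∑ i, f i y) (c • ∑ i, gradient (f i) x) x := by
  rw [hasGradientAt_iff_hasFDerivAt]
  have h := (HasFDerivAt.fun_sum (u := Finset.univ)
    fun i _ => ((hf i) x).hasGradientAt.hasFDerivAt).const_mul c
  simpa [map_sum] using h

/-- Theorem 1 (upper bound on the averaged squared gradient norm) for decentralized
gradient descent with a `(ρ, M)`-robust aggregator under label poisoning attacks. -/
theorem robust_aggregator_learning_error_upper_bound
    (D R K : ℕ) (hD : 0 < D) (hR : 0 < R) (hK : 0 < K)
    (L ξ ρ : ℝ) (hL : 0 < L) (hξ : 0 ≤ ξ) (hρ : 0 ≤ ρ)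
    (f : Fin R → EuclideanSpace ℝ (Fin D) → ℝ)
    (hdiff : ∀ w, Differentiable ℝ (f w))
    (hlip : ∀ w, ∀ x y : EuclideanSpace ℝ (Fin D),
      ‖gradient (f w) x - gradient (f w) y‖ ≤ L * ‖x - y‖)
    (F : EuclideanSpace ℝ (Fin D) → ℝ)
    (hF : F = fun y => (R : ℝ)⁻¹ * ∑ w, f w y)
    (fstar : ℝ) (hlb : ∀ x, F x ≥ fstar)
    (hhet : ∀ (x : EuclideanSpace ℝ (Fin D)) (w : Fin R),
      ‖gradient (f w) x - gradient F x‖ ≤ ξ)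
    (M : Matrix (Fin R) (Fin R) ℝ)
    (hMnonneg : ∀ w v, 0 ≤ M w v) (hMrow : ∀ w, ∑ v, M w v = 1)
    (p : Fin R → ℝ) (hp0 : ∀ w, 0 ≤ p w) (hp1 : ∑ w, p w = 1)
    (hpM : ∀ v, ∑ w, p w * M w v = p v)
    -- `mx g` is the maximum of `g` over the agents
    (mx : (Fin R → ℝ) → ℝ)
    (hmx : ∀ g : Fin R → ℝ, IsGreatest (Set.range g) (mx g))
    (lam β : ℝ)
    (hlam : lam = mx (fun w => ∑ v, |M w v - p v|))
    (hβ : β = ∑ v, |p v - (R : ℝ)⁻¹|)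
    (hlam1 : lam < 1) (hρlam : ρ < (1 - lam) / 4)
    (hKbig : (K : ℝ) ≥ max (16 * (lam + 4 * ρ) ^ 2 * L ^ 2 / (1 - lam - 4 * ρ) ^ 2) (L ^ 2))
    (γ : ℝ) (hγ : γ = 1 / Real.sqrt K)
    (x0 : EuclideanSpace ℝ (Fin D))
    (x xh : ℕ → Fin R → EuclideanSpace ℝ (Fin D))
    (hinit : ∀ w, x 0 w = x0)
    (hhalf : ∀ k w, xh k w = x k w - γ • gradient (f w) (x k w))
    (hagg : ∀ k w, ‖x (k + 1) w - ∑ v, M w v • xh k v‖ ≤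
      ρ * mx (fun v => ‖xh k v - ∑ u, M w u • xh k u‖))
    (xbar : ℕ → EuclideanSpace ℝ (Fin D))
    (hxbar : ∀ k, xbar k = (R : ℝ)⁻¹ • ∑ w, x k w) :
    (K : ℝ)⁻¹ * ∑ k ∈ Finset.range K, ‖gradient F (xbar k)‖ ^ 2 ≤
      4 * (F x0 - fstar) / Real.sqrt K
      + 1024 * (1 + ρ) ^ 2 * L ^ 2 * (lam + 4 * ρ) ^ 2 * ξ ^ 2
          / ((K : ℝ) * (1 - lam - 4 * ρ) ^ 2)
      + 256 * ρ ^ 2 * ξ ^ 2 / (1 - lam - 4 * ρ) ^ 2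
      + 4 * β ^ 2 * ξ ^ 2 := by
  have hR' : (0 : ℝ) < R := by exact_mod_cast hR
  have hK' : (0 : ℝ) < K := by exact_mod_cast hK
  have hsK : 0 < Real.sqrt K := Real.sqrt_pos.2 hK'
  have hsK2 : Real.sqrt K ^ 2 = K := Real.sq_sqrt hK'.le
  have hγ0 : 0 < γ := by rw [hγ]; positivity
  have hγK : γ * Real.sqrt K = 1 := by rw [hγ]; field_simp
  set a := lam + 4 * ρ with ha
  set δ := 1 - lam - 4 * ρ with hδ
  have hδ0 : 0 < δ := by linarith
  have hlamrow : ∀ w, ∑ v, |M w v - p v| ≤ lam := fun w => by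
    rw [hlam]; exact (hmx _).2 ⟨w, rfl⟩
  have hlam0 : 0 ≤ lam :=
    (Finset.sum_nonneg fun v _ => abs_nonneg _).trans (hlamrow ⟨0, hR⟩)
  have ha0 : 0 ≤ a := by positivity
  have hδa : δ = 1 - a := by rw [hδ, ha]; ring
  have hγL : γ * L ≤ 1 := by
    have h : L ≤ Real.sqrt K := Real.le_sqrt_of_sq_le ((le_max_right _ _).trans hKbig)
    calc γ * L ≤ γ * Real.sqrt K := by gcongr
      _ = 1 := hγK
  have hγLa : 4 * (γ * L * a) ≤ δ := by
    have h : (4 * a * L / δ) ^ 2 ≤ K := by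
      refine le_trans (le_of_eq ?_) ((le_max_left _ _).trans hKbig)
      rw [div_pow]; ring
    have h2 : 4 * a * L / δ ≤ Real.sqrt K := Real.le_sqrt_of_sq_le h
    rw [div_le_iff₀ hδ0] at h2
    calc 4 * (γ * L * a) = γ * (4 * a * L) := by ring
      _ ≤ γ * (Real.sqrt K * δ) := by gcongr
      _ = δ := by rw [← mul_assoc, hγK, one_mul]
  -- properties of the average function
  have hgF : ∀ y, HasGradientAt F ((R : ℝ)⁻¹ • ∑ w, gradient (f w) y) y := fun y => by
    rw [hF]; exact hasGradientAt_const_mul_sum hdiff _ y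
  have hFdiff : Differentiable ℝ F := fun y => (hgF y).differentiableAt
  have hunif : ∑ _w : Fin R, (R : ℝ)⁻¹ = 1 := by simp [hR'.ne']
  have hFlip : ∀ y z, ‖gradient F y - gradient F z‖ ≤ L * ‖y - z‖ := by
    intro y z
    rw [(hgF y).gradient, (hgF z).gradient, ← smul_sub, ← Finset.sum_sub_distrib,
      Finset.smul_sum]
    exact norm_sum_smul_le_of_convex_weights (fun _ => by positivity) hunif
      fun w => hlip w y z
  have hcenter : ∀ y, ∑ w, (R : ℝ)⁻¹ • (gradient (f w) y - gradient F y) = 0 := by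
    intro y
    simp only [smul_sub, Finset.sum_sub_distrib, ← Finset.sum_smul, hunif]
    rw [← Finset.smul_sum, (hgF y).gradient, one_smul, sub_self]
  -- consensus
  set C := 4 * a * γ * ξ / δ with hC
  set H := 4 * γ * ξ / δ with hH
  have hC0 : 0 ≤ C := by positivity
  have hH0 : 0 ≤ H := by positivity
  have hhalf_of : ∀ k, (∀ w v, ‖x k w - x k v‖ ≤ C) → ∀ w v, ‖xh k w - xh k v‖ ≤ H := by
    intro k hk w v
    have hgrad : ‖gradient (f w) (x k w) - gradient (f v) (x k v)‖ ≤ L * C + 2 * ξ := by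
      have h1 := (hlip w (x k w) (x k v)).trans (mul_le_mul_of_nonneg_left (hk w v) hL.le)
      have h2 := norm_sub_le_norm_sub_add_norm_sub (gradient (f w) (x k w))
        (gradient (f w) (x k v)) (gradient (f v) (x k v))
      have h3 := norm_sub_le_norm_sub_add_norm_sub (gradient (f w) (x k v))
        (gradient F (x k v)) (gradient (f v) (x k v))
      have h4 := hhet (x k v) w
      have h5 := hhet (x k v) v
      rw [norm_sub_rev] at h5
      linarith
    have hsplit : xh k w - xh k v = (x k w - x k v)
        - γ • (gradient (f w) (x k w) - gradient (f v) (x k v)) := by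
      rw [hhalf, hhalf, smul_sub]; abel
    have hCle : C + γ * (L * C + 2 * ξ) ≤ H := by
      have : C + γ * (L * C + 2 * ξ) = (4 * a + 4 * (γ * L * a) + 2 * δ) * (γ * ξ) / δ := by
        rw [hC]; field_simp; ring
      rw [this, hH, mul_assoc 4 γ ξ]
      gcongr
      linarith
    calc ‖xh k w - xh k v‖
        ≤ ‖x k w - x k v‖ + ‖γ • (gradient (f w) (x k w) - gradient (f v) (x k v))‖ := by
          rw [hsplit]; exact norm_sub_le _ _
      _ ≤ C + γ * (L * C + 2 * ξ) := by
          rw [norm_smul, Real.norm_of_nonneg hγ0.le]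
          gcongr
          exact hk w v
      _ ≤ H := hCle
  have hagg_of : ∀ k, (∀ w v, ‖xh k w - xh k v‖ ≤ H) →
      ∀ w, ‖x (k + 1) w - ∑ v, M w v • xh k v‖ ≤ ρ * H := by
    intro k hk w
    refine (hagg k w).trans (mul_le_mul_of_nonneg_left ?_ hρ)
    obtain ⟨v, hv⟩ := (hmx fun v => ‖xh k v - ∑ u, M w u • xh k u‖).1
    rw [← hv]
    change ‖xh k v - _‖ ≤ H
    rw [norm_sub_rev]
    exact norm_sum_smul_sub_le_of_convex_weights (hMnonneg w) (hMrow w) fun u => hk u v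
  have hcons : ∀ k w v, ‖x k w - x k v‖ ≤ C := by
    intro k
    induction k with
    | zero => intro w v; simpa [hinit] using hC0
    | succ k ih =>
      intro w v
      have hk := hhalf_of k ih
      have h1 := hagg_of k hk w
      have h2 := hagg_of k hk v
      rw [norm_sub_rev] at h2
      have h3 := norm_sum_smul_sub_sum_smul_le_total_variation
        ((hMrow w).trans (hMrow v).symm) hk
      have hrow : ∑ u, |M w u - M v u| ≤ lam + lam := by
        refine le_trans ?_ (add_le_add (hlamrow w) (hlamrow v))
        rw [← Finset.sum_add_distrib]
        refine Finset.sum_le_sum fun u _ => ?_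
        rw [abs_sub_comm (M v u)]
        exact abs_sub_le _ _ _
      have h4 : (∑ u, |M w u - M v u|) / 2 * H ≤ lam * H :=
        mul_le_mul_of_nonneg_right (by linarith) hH0
      have h5 := norm_sub_le_norm_sub_add_norm_sub (x (k + 1) w)
        (∑ u, M w u • xh k u) (x (k + 1) v)
      have h6 := norm_sub_le_norm_sub_add_norm_sub (∑ u, M w u • xh k u)
        (∑ u, M v u • xh k u) (x (k + 1) v)
      have h7 : a * H = C := by rw [hC, hH]; ring
      have h8 : a * H = lam * H + 4 * (ρ * H) := by rw [ha]; ring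
      have h9 : 0 ≤ ρ * H := mul_nonneg hρ hH0
      linarith
  have hconsh := fun k => hhalf_of k (hcons k)
  -- the Perron average and its inexact gradient step
  set z : ℕ → EuclideanSpace ℝ (Fin D) := fun k => ∑ w, p w • x k w with hz
  have hxz : ∀ k w, ‖x k w - z k‖ ≤ C := fun k w => by
    rw [norm_sub_rev]
    exact norm_sum_smul_sub_le_of_convex_weights hp0 hp1 fun v => hcons k v w
  have hbarz : ∀ k, ‖xbar k - z k‖ ≤ C := fun k => by
    rw [hxbar, Finset.smul_sum]
    exact norm_sum_smul_sub_le_of_convex_weights (fun _ => by positivity) hunif (hxz k)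
  have hbias : ∀ y, ‖∑ w, p w • gradient (f w) y - gradient F y‖ ≤ β * ξ := by
    intro y
    have : ∑ w, p w • gradient (f w) y - gradient F y
        = ∑ w, (p w - (R : ℝ)⁻¹) • (gradient (f w) y - gradient F y) := by
      simp only [sub_smul _ _ (gradient _ _ - _), Finset.sum_sub_distrib, hcenter]
      simp only [smul_sub, Finset.sum_sub_distrib, ← Finset.sum_smul, hp1, one_smul, sub_zero]
    rw [this, hβ, Finset.sum_mul]
    refine norm_sum_le_of_le _ fun w _ => ?_
    rw [norm_smul, Real.norm_eq_abs]
    exact mul_le_mul_of_nonneg_left (hhet y w) (abs_nonneg _)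
  have hzh : ∀ k, ‖z (k + 1) - ∑ w, p w • xh k w‖ ≤ ρ * H := by
    intro k
    have hperron : ∑ w, p w • xh k w = ∑ w, p w • ∑ v, M w v • xh k v := by
      simp only [Finset.smul_sum, smul_smul]
      rw [Finset.sum_comm]
      simp only [← Finset.sum_smul, hpM]
    rw [hperron, hz]
    simp only [← Finset.sum_sub_distrib, ← smul_sub]
    exact norm_sum_smul_le_of_convex_weights hp0 hp1 fun w => hagg_of k (hconsh k) w
  set A := L * C with hA
  set B := 4 * ρ * ξ / δ with hB
  have hstep : ∀ k, γ / 2 * ‖gradient F (z k)‖ ^ 2 ≤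
      F (z k) - F (z (k + 1)) + γ / 2 * (β * ξ + A + B) ^ 2 := by
    intro k
    set G := γ⁻¹ • (z k - z (k + 1)) with hG
    have hzG : z k - γ • G = z (k + 1) := by
      rw [hG, smul_inv_smul₀ hγ0.ne']; abel
    have hsplit : G - gradient F (z k)
        = (∑ w, p w • gradient (f w) (z k) - gradient F (z k))
          + ∑ w, p w • (gradient (f w) (x k w) - gradient (f w) (z k))
          - γ⁻¹ • (z (k + 1) - ∑ w, p w • xh k w) := by
      have hxh : ∑ w, p w • xh k w = z k - γ • ∑ w, p w • gradient (f w) (x k w) := by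
        rw [hz, Finset.smul_sum, ← Finset.sum_sub_distrib]
        refine Finset.sum_congr rfl fun w _ => ?_
        rw [hhalf, smul_sub, smul_comm]
      rw [hG, hxh]
      simp only [smul_sub, Finset.sum_sub_distrib, inv_smul_smul₀ hγ0.ne']
      abel
    have h1 := hbias (z k)
    have h2 : ‖∑ w, p w • (gradient (f w) (x k w) - gradient (f w) (z k))‖ ≤ A :=
      norm_sum_smul_le_of_convex_weights hp0 hp1 fun w =>
        (hlip w (x k w) (z k)).trans (mul_le_mul_of_nonneg_left (hxz k w) hL.le)
    have h3 : ‖γ⁻¹ • (z (k + 1) - ∑ w, p w • xh k w)‖ ≤ B := by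
      rw [norm_smul, Real.norm_of_nonneg (inv_nonneg.2 hγ0.le)]
      calc γ⁻¹ * ‖z (k + 1) - ∑ w, p w • xh k w‖ ≤ γ⁻¹ * (ρ * H) :=
            mul_le_mul_of_nonneg_left (hzh k) (inv_nonneg.2 hγ0.le)
        _ = B := by rw [hB, hH]; field_simp
    have hnorm : ‖G - gradient F (z k)‖ ≤ β * ξ + A + B := by
      rw [hsplit]
      exact (norm_sub_le _ _).trans (add_le_add ((norm_add_le _ _).trans (add_le_add h1 h2)) h3)
    have hdesc := inexact_gradient_step_le hFdiff hFlip hγ0.le hγL (z k) G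
    rw [hzG] at hdesc
    have : γ / 2 * ‖G - gradient F (z k)‖ ^ 2 ≤ γ / 2 * (β * ξ + A + B) ^ 2 := by gcongr
    linarith
  have hterm : ∀ k, ‖gradient F (xbar k)‖ ^ 2 ≤
      4 * Real.sqrt K * (F (z k) - F (z (k + 1)))
        + (4 * (β * ξ) ^ 2 + 10 * A ^ 2 + 8 * B ^ 2) := by
    intro k
    have h1 : ‖gradient F (xbar k)‖ ≤ ‖gradient F (z k)‖ + A := by
      have h := (hFlip (xbar k) (z k)).trans (mul_le_mul_of_nonneg_left (hbarz k) hL.le)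
      have := norm_sub_norm_le (gradient F (xbar k)) (gradient F (z k))
      linarith
    have h2 : ‖gradient F (xbar k)‖ ^ 2 ≤ 2 * ‖gradient F (z k)‖ ^ 2 + 2 * A ^ 2 := by
      have := pow_le_pow_left₀ (norm_nonneg _) h1 2
      linarith [sq_nonneg (‖gradient F (z k)‖ - A)]
    have h3 := mul_le_mul_of_nonneg_left (hstep k) (by positivity : 0 ≤ 4 * Real.sqrt K)
    have h4 : ∀ t, 4 * Real.sqrt K * (γ / 2 * t) = 2 * t := fun t => by
      linear_combination 2 * t * hγK
    rw [mul_add, h4, h4] at h3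
    linarith [sq_nonneg (β * ξ - (A + B)), sq_nonneg (A - B)]
  have hsum : ∑ k ∈ Finset.range K, ‖gradient F (xbar k)‖ ^ 2 ≤
      4 * Real.sqrt K * (F x0 - fstar)
        + K * (4 * (β * ξ) ^ 2 + 10 * A ^ 2 + 8 * B ^ 2) := by
    have hz0 : z 0 = x0 := by
      simp only [hz, hinit, ← Finset.sum_smul, hp1, one_smul]
    refine (Finset.sum_le_sum fun k _ => hterm k).trans ?_
    rw [Finset.sum_add_distrib, ← Finset.mul_sum, Finset.sum_range_sub', hz0, Finset.sum_const,
      Finset.card_range, nsmul_eq_mul]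
    gcongr
    exact hlb _
  have hA2 : 10 * A ^ 2 ≤ 1024 * (1 + ρ) ^ 2 * L ^ 2 * a ^ 2 * ξ ^ 2 / (K * δ ^ 2) := by
    have hγ2 : γ ^ 2 = 1 / K := by rw [hγ, div_pow, hsK2, one_pow]
    have : 10 * A ^ 2 = 160 * (L ^ 2 * a ^ 2 * ξ ^ 2 / (K * δ ^ 2)) := by
      rw [hA, hC, mul_pow, div_pow, mul_pow, mul_pow, hγ2]; field_simp; ring
    have h1 : (1 : ℝ) ≤ (1 + ρ) ^ 2 := one_le_pow₀ (by linarith)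
    have h2 : 0 ≤ L ^ 2 * a ^ 2 * ξ ^ 2 / (K * δ ^ 2) := by positivity
    rw [this]
    calc 160 * (L ^ 2 * a ^ 2 * ξ ^ 2 / (K * δ ^ 2))
        ≤ (1024 * (1 + ρ) ^ 2) * (L ^ 2 * a ^ 2 * ξ ^ 2 / (K * δ ^ 2)) := by
          gcongr; linarith
      _ = _ := by ring
  have hB2 : 8 * B ^ 2 ≤ 256 * ρ ^ 2 * ξ ^ 2 / δ ^ 2 := by
    have : 256 * ρ ^ 2 * ξ ^ 2 / δ ^ 2 = 16 * B ^ 2 := by rw [hB, div_pow]; ring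
    rw [this]
    linarith [sq_nonneg B]
  have hfirst : (K : ℝ)⁻¹ * (4 * Real.sqrt K * (F x0 - fstar))
      = 4 * (F x0 - fstar) / Real.sqrt K := by
    rw [eq_div_iff hsK.ne', inv_mul_eq_div, div_mul_eq_mul_div, div_eq_iff hK'.ne']
    linear_combination 4 * (F x0 - fstar) * hsK2
  calc (K : ℝ)⁻¹ * ∑ k ∈ Finset.range K, ‖gradient F (xbar k)‖ ^ 2
      ≤ (K : ℝ)⁻¹ * (4 * Real.sqrt K * (F x0 - fstar)
        + K * (4 * (β * ξ) ^ 2 + 10 * A ^ 2 + 8 * B ^ 2)) := by gcongr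
    _ = 4 * (F x0 - fstar) / Real.sqrt K
        + (4 * (β * ξ) ^ 2 + 10 * A ^ 2 + 8 * B ^ 2) := by
        rw [mul_add, hfirst, inv_mul_cancel_left₀ hK'.ne']
    _ ≤ _ := by rw [mul_pow]; linarith
end

section
/- Let D, R, K be positive integers, L > 0, ξ ≥ 0, ρ ≥ 0, and for each w ∈ {1,…,R} let f_w : ℝ^D → ℝ be differentiable with L-Lipschitz gradient. Set f = (1/R)·Σ_{w=1}^R f_w and assume sup_x max_w ‖∇f_w(x) − ∇f(x)‖ ≤ ξ. Let M ∈ ℝ^{R×R} be row-stochastic with a Perron vector p, let λ = max_w Σ_v |M_{wv} − p_v|, and assume λ < 1, ρ < (1−λ)/4, and K ≥ max{16(λ+4ρ)²L²/(1−λ−4ρ)², L²}. Set γ = 1/√K and let iterates x_w^k ∈ ℝ^D satisfy: x_w^0 = x^0 for all w; x_w^{k+½} = x_w^k − γ∇f_w(x_w^k); and for every w and k, ‖x_w^{k+1} − Σ_v M_{wv} x_v^{k+½}‖ ≤ ρ · max_{v∈{1,…,R}} ‖x_v^{k+½} − Σ_u M_{wu} x_u^{k+½}‖. Then, with x̄^k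 = (1/R)Σ_w x_w^k, for every k ∈ {0,1,…,K} the consensus error satisfies max_{w∈{1,…,R}} ‖x_w^k − x̄^k‖² ≤ 64(λ+4ρ)²ξ²/(K(1−λ−4ρ)²). -/
open Finset

section WeightedSums

variable {ι E : Type*} [Fintype ι] [NormedAddCommGroup E] [NormedSpace ℝ E]

/-- A linear combination of vectors of norm at most `B` is bounded by `B` times the `ℓ¹` norm of
the weights. -/
theorem norm_sum_smul_le_sum_abs_mul (a : ι → ℝ) (z : ι → E) {B : ℝ} (hz : ∀ i, ‖z i‖ ≤ B) :
    ‖∑ i, a i • z i‖ ≤ (∑ i, |a i|) * B := by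
  rw [Finset.sum_mul]
  refine norm_sum_le_of_le _ fun i _ => ?_
  rw [norm_smul, Real.norm_eq_abs]
  exact mul_le_mul_of_nonneg_left (hz i) (abs_nonneg _)

/-- Convex combinations stay in a ball that contains the points. -/
theorem norm_convex_sum_sub_le (a : ι → ℝ) (ha : ∀ i, 0 ≤ a i) (hsum : ∑ i, a i = 1)
    (z : ι → E) (c : E) {B : ℝ} (hz : ∀ i, ‖z i - c‖ ≤ B) :
    ‖∑ i, a i • z i - c‖ ≤ B := by
  have h := norm_sum_smul_le_sum_abs_mul a (fun i => z i - c) hz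
  simpa only [smul_sub, Finset.sum_sub_distrib, ← Finset.sum_smul, hsum, one_smul,
    abs_of_nonneg (ha _), one_mul] using h

/-- Two weighted means of points in a ball of radius `B` differ by at most `B` times the `ℓ¹`
distance of the weights. -/
theorem norm_sum_smul_sub_sum_smul_le (a b : ι → ℝ) (hab : ∑ i, a i = ∑ i, b i)
    (z : ι → E) (c : E) {B : ℝ} (hz : ∀ i, ‖z i - c‖ ≤ B) :
    ‖∑ i, a i • z i - ∑ i, b i • z i‖ ≤ (∑ i, |a i - b i|) * B := by
  have h := norm_sum_smul_le_sum_abs_mul (fun i => a i - b i) (fun i => z i - c) hz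
  simpa only [smul_sub, sub_smul, Finset.sum_sub_distrib, ← Finset.sum_smul, hab, sub_self,
    sub_zero] using h

end WeightedSums

/-- One gradient step enlarges a ball of radius `B` around `c` to a ball around the averaged step
from `c`, at the cost of the Lipschitz constant and the heterogeneity. -/
theorem norm_gradient_step_sub_le {E : Type*} [NormedAddCommGroup E] [NormedSpace ℝ E]
    {G H : E → E} {L ξ γ B : ℝ} (hL : 0 ≤ L) (hγ : 0 ≤ γ)
    (hlip : ∀ x y, ‖G x - G y‖ ≤ L * ‖x - y‖) (hhet : ∀ x, ‖G x - H x‖ ≤ ξ)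
    {x c : E} (hx : ‖x - c‖ ≤ B) :
    ‖(x - γ • G x) - (c - γ • H c)‖ ≤ B + γ * (L * B + ξ) := by
  have hGH : ‖G x - H c‖ ≤ L * B + ξ :=
    (norm_sub_le_norm_sub_add_norm_sub _ (G c) _).trans
      (add_le_add ((hlip x c).trans (mul_le_mul_of_nonneg_left hx hL)) (hhet c))
  have hsplit : (x - γ • G x) - (c - γ • H c) = (x - c) - γ • (G x - H c) := by
    rw [smul_sub]; abel
  rw [hsplit]
  refine (norm_sub_le _ _).trans (add_le_add hx ?_)
  rw [norm_smul, Real.norm_of_nonneg hγ]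
  exact mul_le_mul_of_nonneg_left hGH hγ

/-- Theorem 1 (consensus error bound) for decentralized gradient descent with a
`(ρ, M)`-robust aggregator under label poisoning attacks. -/
theorem robust_aggregator_consensus_error_upper_bound
    (D R K : ℕ) (hD : 0 < D) (hR : 0 < R) (hK : 0 < K)
    (L ξ ρ : ℝ) (hL : 0 < L) (hξ : 0 ≤ ξ) (hρ : 0 ≤ ρ)
    (f : Fin R → EuclideanSpace ℝ (Fin D) → ℝ)
    (hdiff : ∀ w, Differentiable ℝ (f w))
    (hlip : ∀ w, ∀ x y : EuclideanSpace ℝ (Fin D),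
      ‖gradient (f w) x - gradient (f w) y‖ ≤ L * ‖x - y‖)
    (F : EuclideanSpace ℝ (Fin D) → ℝ)
    (hF : F = fun y => (R : ℝ)⁻¹ * ∑ w, f w y)
    (hhet : ∀ (x : EuclideanSpace ℝ (Fin D)) (w : Fin R),
      ‖gradient (f w) x - gradient F x‖ ≤ ξ)
    (M : Matrix (Fin R) (Fin R) ℝ)
    (hMnonneg : ∀ w v, 0 ≤ M w v) (hMrow : ∀ w, ∑ v, M w v = 1)
    (p : Fin R → ℝ) (hp0 : ∀ w, 0 ≤ p w) (hp1 : ∑ w, p w = 1)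
    (hpM : ∀ v, ∑ w, p w * M w v = p v)
    -- `mx g` is the maximum of `g` over the agents
    (mx : (Fin R → ℝ) → ℝ)
    (hmx : ∀ g : Fin R → ℝ, IsGreatest (Set.range g) (mx g))
    (lam : ℝ)
    (hlam : lam = mx (fun w => ∑ v, |M w v - p v|))
    (hlam1 : lam < 1) (hρlam : ρ < (1 - lam) / 4)
    (hKbig : (K : ℝ) ≥ max (16 * (lam + 4 * ρ) ^ 2 * L ^ 2 / (1 - lam - 4 * ρ) ^ 2) (L ^ 2))
    (γ : ℝ) (hγ : γ = 1 / Real.sqrt K)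
    (x0 : EuclideanSpace ℝ (Fin D))
    (x xh : ℕ → Fin R → EuclideanSpace ℝ (Fin D))
    (hinit : ∀ w, x 0 w = x0)
    (hhalf : ∀ k w, xh k w = x k w - γ • gradient (f w) (x k w))
    (hagg : ∀ k w, ‖x (k + 1) w - ∑ v, M w v • xh k v‖ ≤
      ρ * mx (fun v => ‖xh k v - ∑ u, M w u • xh k u‖))
    (xbar : ℕ → EuclideanSpace ℝ (Fin D))
    (hxbar : ∀ k, xbar k = (R : ℝ)⁻¹ • ∑ w, x k w) :
    ∀ k ≤ K, mx (fun w => ‖x k w - xbar k‖ ^ 2) ≤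
      64 * (lam + 4 * ρ) ^ 2 * ξ ^ 2 / ((K : ℝ) * (1 - lam - 4 * ρ) ^ 2) := by
  have hmx_le : ∀ (g : Fin R → ℝ) (B : ℝ), (∀ w, g w ≤ B) → mx g ≤ B := by
    intro g B hg
    obtain ⟨w, hw⟩ := (hmx g).1
    exact hw ▸ hg w
  have hlam_ge : ∀ w, ∑ v, |M w v - p v| ≤ lam := fun w =>
    hlam ▸ (hmx fun w => ∑ v, |M w v - p v|).2 ⟨w, rfl⟩
  have hlam0 : 0 ≤ lam :=
    (Finset.sum_nonneg fun v _ => abs_nonneg (M ⟨0, hR⟩ v - p v)).trans (hlam_ge ⟨0, hR⟩)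
  obtain ⟨q, hq⟩ : ∃ q, q = lam + 4 * ρ := ⟨_, rfl⟩
  have hq0 : 0 ≤ q := by linarith
  have hq1 : 0 < 1 - q := by linarith
  have hqsub : 1 - lam - 4 * ρ = 1 - q := by linarith
  rw [hqsub, ← hq] at hKbig ⊢
  have hKpos : (0 : ℝ) < K := Nat.cast_pos.mpr hK
  have hγ0 : 0 ≤ γ := by rw [hγ]; positivity
  have hγsq : γ ^ 2 = 1 / K := by rw [hγ, div_pow, Real.sq_sqrt hKpos.le, one_pow]
  have hstep : 4 * (q * (γ * L)) ≤ 1 - q := by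
    have h := (le_max_left _ _).trans hKbig
    rw [div_le_iff₀ (by positivity)] at h
    refine le_of_sq_le_sq ?_ hq1.le
    calc (4 * (q * (γ * L))) ^ 2 = 16 * q ^ 2 * L ^ 2 * γ ^ 2 := by ring
      _ ≤ K * (1 - q) ^ 2 * γ ^ 2 := by gcongr
      _ = (1 - q) ^ 2 := by rw [hγsq]; field_simp
  obtain ⟨B, hB⟩ : ∃ B, B = 4 * q * γ * ξ / (1 - q) := ⟨_, rfl⟩
  have hB0 : 0 ≤ B := by rw [hB]; positivity
  have hBq : (1 - q) * B = 4 * (q * (γ * ξ)) := by rw [hB]; field_simp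
  have hcontract : q * (B + γ * (L * B + ξ)) ≤ B := by
    nlinarith [mul_le_mul_of_nonneg_right hstep hB0, mul_nonneg hq1.le hB0]
  have hball : ∀ k, ∃ c, ∀ w, ‖x k w - c‖ ≤ B := by
    intro k
    induction k with
    | zero => exact ⟨x0, fun w => by simpa [hinit w] using hB0⟩
    | succ k ih =>
      obtain ⟨c, hc⟩ := ih
      obtain ⟨Y, hY⟩ : ∃ Y, Y = B + γ * (L * B + ξ) := ⟨_, rfl⟩
      rw [← hY] at hcontract
      have hY0 : 0 ≤ Y := by rw [hY]; positivity
      have hyc : ∀ v, ‖xh k v - (c - γ • gradient F c)‖ ≤ Y := fun v => by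
        rw [hhalf, hY]
        exact norm_gradient_step_sub_le hL.le hγ0 (hlip v) (fun y => hhet y v) (hc v)
      refine ⟨∑ v, p v • xh k v, fun w => ?_⟩
      have hdev : mx (fun v => ‖xh k v - ∑ u, M w u • xh k u‖) ≤ Y + Y := by
        refine hmx_le _ _ fun v => (norm_sub_le_norm_sub_add_norm_sub _ _ _).trans
          (add_le_add (hyc v) ?_)
        rw [norm_sub_rev]
        exact norm_convex_sum_sub_le _ (hMnonneg w) (hMrow w) _ _ hyc
      have hmix : ‖∑ v, M w v • xh k v - ∑ v, p v • xh k v‖ ≤ lam * Y :=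
        (norm_sum_smul_sub_sum_smul_le _ _ ((hMrow w).trans hp1.symm) _ _ hyc).trans
          (mul_le_mul_of_nonneg_right (hlam_ge w) hY0)
      calc ‖x (k + 1) w - ∑ v, p v • xh k v‖
          ≤ ρ * (Y + Y) + lam * Y :=
            (norm_sub_le_norm_sub_add_norm_sub _ _ _).trans
              (add_le_add ((hagg k w).trans (mul_le_mul_of_nonneg_left hdev hρ)) hmix)
        _ ≤ q * Y := by rw [hq]; nlinarith [mul_nonneg hρ hY0]
        _ ≤ B := hcontract
  intro k _
  obtain ⟨c, hc⟩ := hball k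
  refine hmx_le _ _ fun w => ?_
  have hRne : (R : ℝ) ≠ 0 := Nat.cast_ne_zero.mpr hR.ne'
  have hmean : ‖c - xbar k‖ ≤ B := by
    rw [norm_sub_rev, hxbar, Finset.smul_sum]
    exact norm_convex_sum_sub_le _ (fun _ => by positivity) (by simp [hRne]) _ _ hc
  calc ‖x k w - xbar k‖ ^ 2 ≤ (B + B) ^ 2 := by
        gcongr
        exact (norm_sub_le_norm_sub_add_norm_sub _ c _).trans (add_le_add (hc w) hmean)
    _ = 64 * q ^ 2 * ξ ^ 2 * γ ^ 2 / (1 - q) ^ 2 := by rw [hB]; field_simp; ring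
    _ = 64 * q ^ 2 * ξ ^ 2 / (K * (1 - q) ^ 2) := by rw [hγsq]; field_simp
end

section
/- Let D, W, K be positive integers, let 𝓡 ⊆ {1,…,W} be nonempty with |𝓡| = R, let L > 0, ξ ≥ 0, A ≥ 0, and set δ = 1 − R/W. For each w ∈ {1,…,W} let f̂_w : ℝ^D → ℝ be differentiable with L-Lipschitz gradient, set f = (1/R)·Σ_{w∈𝓡} f̂_w, and assume sup_x max_{w∈𝓡} ‖∇f̂_w(x) − ∇f(x)‖ ≤ ξ and sup_x max_{w∉𝓡} ‖∇f̂_w(x) − ∇f(x)‖ ≤ A. Let E ∈ ℝ^{W×W} be doubly stochastic with λ' = ‖E − (1/W)𝟙𝟙ᵀ‖ < 1 (operator 2-norm), and assume K ≥ max{24λ'²L²/(1−λ')², L²}. Set γ = 1/√K and define iterates by x̂_w^0 = x^0 for all w and x̂_w^{k+1} = Σ_{v=1}^W E_{wv}·(x̂_v^k − γ∇f̂_v(x̂_v^k)). Then, with x̄^k = (1/R)Σ_{w∈𝓡} x̂_w^k, for every k ∈ {0,1,…,K} the consensus error satisfies max_{w∈𝓡} ‖x̂_w^k − x̄^k‖²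 ≤ 48W(1 + W/R)·λ'²·(δ²A² + max{ξ², A²})/(K·(1−λ')²). -/
open Finset

/-- A real matrix acting on tuples of Euclidean vectors has Frobenius-type operator norm at most its
spectral norm. -/
lemma norm_toLp_matrix_smul_le {m D : Type*} [Fintype m] [DecidableEq m] [Fintype D]
    (M : Matrix m m ℝ) (Z : m → EuclideanSpace ℝ D) :
    ‖(WithLp.toLp 2 (fun w => ∑ v, M w v • Z v) : PiLp 2 fun _ : m => EuclideanSpace ℝ D)‖ ≤
      ‖Matrix.toEuclideanCLM (𝕜 := ℝ) M‖ *
        ‖(WithLp.toLp 2 Z : PiLp 2 fun _ : m => EuclideanSpace ℝ D)‖ := by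
  refine le_of_sq_le_sq ?_ (by positivity)
  rw [mul_pow, PiLp.norm_sq_eq_of_L2, PiLp.norm_sq_eq_of_L2]
  simp only [EuclideanSpace.norm_sq_eq (𝕜 := ℝ)]
  rw [Finset.sum_comm, Finset.sum_comm (s := univ (α := m)), Finset.mul_sum]
  refine Finset.sum_le_sum fun d _ => ?_
  have h := (Matrix.toEuclideanCLM (𝕜 := ℝ) M).le_opNorm (WithLp.toLp 2 fun v => Z v d)
  have h2 := pow_le_pow_left₀ (norm_nonneg _) h 2
  rw [mul_pow, EuclideanSpace.norm_sq_eq, EuclideanSpace.norm_sq_eq] at h2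
  simpa [Matrix.mulVec, dotProduct] using h2

/-- Componentwise domination bounds the `ℓ²` norm of a tuple. -/
lemma norm_toLp_le_mul_norm_toLp {m V V' : Type*} [Fintype m] [SeminormedAddCommGroup V]
    [SeminormedAddCommGroup V'] (Y : m → V) (Z : m → V') (c : ℝ) (hc : 0 ≤ c)
    (h : ∀ w, ‖Y w‖ ≤ c * ‖Z w‖) :
    ‖(WithLp.toLp 2 Y : PiLp 2 fun _ : m => V)‖ ≤
      c * ‖(WithLp.toLp 2 Z : PiLp 2 fun _ : m => V')‖ := by
  refine le_of_sq_le_sq ?_ (by positivity)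
  rw [mul_pow, PiLp.norm_sq_eq_of_L2, PiLp.norm_sq_eq_of_L2, Finset.mul_sum]
  refine Finset.sum_le_sum fun w _ => ?_
  rw [← mul_pow]
  exact pow_le_pow_left₀ (norm_nonneg _) (h w) 2

/-- A uniform componentwise bound controls the `ℓ²` norm of a tuple. -/
lemma norm_toLp_le_sqrt_card_mul {m V : Type*} [Fintype m] [SeminormedAddCommGroup V]
    (Y : m → V) (c : ℝ) (hc : 0 ≤ c) (h : ∀ w, ‖Y w‖ ≤ c) :
    ‖(WithLp.toLp 2 Y : PiLp 2 fun _ : m => V)‖ ≤ √(Fintype.card m) * c := by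
  refine le_of_sq_le_sq ?_ (by positivity)
  rw [mul_pow, Real.sq_sqrt (Nat.cast_nonneg _), PiLp.norm_sq_eq_of_L2]
  refine (Finset.sum_le_sum fun w _ => pow_le_pow_left₀ (norm_nonneg _) (h w) 2).trans ?_
  simp

/-- Gossip averaging with a doubly stochastic matrix acts on deviations from the mean through
`E - J`, up to an arbitrary common shift. -/
lemma sum_smul_sub_mean_eq {W : ℕ} (hW : 0 < W) {V : Type*} [AddCommGroup V] [Module ℝ V]
    (E : Matrix (Fin W) (Fin W) ℝ)
    (hErow : ∀ w, ∑ v, E w v = 1) (hEcol : ∀ v, ∑ w, E w v = 1)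
    (J : Matrix (Fin W) (Fin W) ℝ) (hJ : J = Matrix.of fun _ _ => (W : ℝ)⁻¹)
    (Z : Fin W → V) (b : V) (w : Fin W) :
    (∑ v, E w v • Z v) - (W : ℝ)⁻¹ • ∑ u, ∑ v, E u v • Z v =
      ∑ v, (E - J) w v • (Z v - b) := by
  have hW' : (W : ℝ) ≠ 0 := by positivity
  subst hJ
  rw [Finset.sum_comm (s := univ)]
  simp only [← Finset.sum_smul, hEcol, one_smul, Matrix.sub_apply, Matrix.of_apply, smul_sub,
    Finset.sum_sub_distrib, sub_smul, hErow, Finset.smul_sum]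
  simp [hW']

/-- The deviation of a tuple member from a partial mean is at most twice a uniform bound on the
deviations from any common reference point. -/
lemma norm_sub_mean_le {ι V : Type*} [NormedAddCommGroup V] [NormedSpace ℝ V]
    (s : Finset ι) (x : ι → V) (c : V) (B : ℝ) (h : ∀ v ∈ s, ‖x v - c‖ ≤ B)
    {w : ι} (hw : w ∈ s) :
    ‖x w - (s.card : ℝ)⁻¹ • ∑ v ∈ s, x v‖ ≤ 2 * B := by
  have hs : (0 : ℝ) < s.card := by exact_mod_cast Finset.card_pos.mpr ⟨w, hw⟩
  have hmean : ‖(s.card : ℝ)⁻¹ • ∑ v ∈ s, (x v - c)‖ ≤ B := by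
    rw [norm_smul, norm_inv, Real.norm_of_nonneg hs.le, inv_mul_le_iff₀ hs]
    simpa using Finset.sum_le_card_nsmul s _ B h |>.trans' (norm_sum_le s fun v => x v - c)
  have heq : x w - (s.card : ℝ)⁻¹ • ∑ v ∈ s, x v =
      (x w - c) - (s.card : ℝ)⁻¹ • ∑ v ∈ s, (x v - c) := by
    rw [Finset.sum_sub_distrib, smul_sub, Finset.sum_const, ← Nat.cast_smul_eq_nsmul ℝ, smul_smul,
      inv_mul_cancel₀ hs.ne', one_smul]
    abel
  rw [heq]
  linarith [norm_sub_le (x w - c) ((s.card : ℝ)⁻¹ • ∑ v ∈ s, (x v - c)), h w hw]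

/-- One gossip gradient step contracts the total deviation from the mean, up to a drift
proportional to the gradient dissimilarity `M`. -/
lemma norm_deviation_gossip_step_le {W D : ℕ} (hW : 0 < W) (L M γ : ℝ) (hL : 0 ≤ L) (hM : 0 ≤ M)
    (hγ : 0 ≤ γ) (g : Fin W → EuclideanSpace ℝ (Fin D) → EuclideanSpace ℝ (Fin D))
    (hlip : ∀ w x y, ‖g w x - g w y‖ ≤ L * ‖x - y‖)
    (G : EuclideanSpace ℝ (Fin D) → EuclideanSpace ℝ (Fin D))
    (hG : ∀ x w, ‖g w x - G x‖ ≤ M)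
    (E : Matrix (Fin W) (Fin W) ℝ)
    (hErow : ∀ w, ∑ v, E w v = 1) (hEcol : ∀ v, ∑ w, E w v = 1)
    (J : Matrix (Fin W) (Fin W) ℝ) (hJ : J = Matrix.of fun _ _ => (W : ℝ)⁻¹)
    (x y : Fin W → EuclideanSpace ℝ (Fin D))
    (hy : ∀ w, y w = ∑ v, E w v • (x v - γ • g v (x v))) :
    ‖(WithLp.toLp 2 (fun w => y w - (W : ℝ)⁻¹ • ∑ v, y v) :
        PiLp 2 fun _ : Fin W => EuclideanSpace ℝ (Fin D))‖ ≤
      ‖Matrix.toEuclideanCLM (𝕜 := ℝ) (E - J)‖ *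
        ((1 + γ * L) * ‖(WithLp.toLp 2 (fun w => x w - (W : ℝ)⁻¹ • ∑ v, x v) :
          PiLp 2 fun _ : Fin W => EuclideanSpace ℝ (Fin D))‖ + γ * (√W * M)) := by
  set c := (W : ℝ)⁻¹ • ∑ v, x v with hc
  simp only [hy, sum_smul_sub_mean_eq hW E hErow hEcol J hJ _ (c - γ • G c)]
  refine (norm_toLp_matrix_smul_le _ _).trans (mul_le_mul_of_nonneg_left ?_ (norm_nonneg _))
  have hsplit : (WithLp.toLp 2 (fun v => x v - γ • g v (x v) - (c - γ • G c)) :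
      PiLp 2 fun _ : Fin W => EuclideanSpace ℝ (Fin D)) =
      WithLp.toLp 2 (fun v => x v - c) - γ • (WithLp.toLp 2 (fun v => g v (x v) - g v c) +
        WithLp.toLp 2 (fun v => g v c - G c)) := by
    ext1 v
    simp only [PiLp.sub_apply, PiLp.smul_apply, PiLp.add_apply, smul_add, smul_sub]
    abel
  have hvar := norm_toLp_le_mul_norm_toLp (fun v => g v (x v) - g v c) (fun v => x v - c) L hL
    fun v => hlip v _ _
  have hdis := norm_toLp_le_sqrt_card_mul (fun v => g v c - G c) M hM fun v => hG c v
  rw [Fintype.card_fin] at hdis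
  rw [hsplit]
  refine (norm_sub_le _ _).trans ?_
  rw [norm_smul, Real.norm_of_nonneg hγ]
  have := mul_le_mul_of_nonneg_left ((norm_add_le _ _).trans (add_le_add hvar hdis)) hγ
  linarith

/-- Theorem 2 (consensus error bound) for decentralized
gradient descent with the weighted mean aggregator under label poisoning attacks. -/
theorem weighted_mean_consensus_error_upper_bound
    (D W K : ℕ) (hD : 0 < D) (hW : 0 < W) (hK : 0 < K)
    (Reg : Finset (Fin W)) (hReg : Reg.Nonempty)
    (R : ℕ) (hR : R = Reg.card)
    (L ξ A δ : ℝ) (hL : 0 < L) (hξ : 0 ≤ ξ) (hA : 0 ≤ A)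
    (hδ : δ = 1 - (R : ℝ) / (W : ℝ))
    (f : Fin W → EuclideanSpace ℝ (Fin D) → ℝ)
    (hdiff : ∀ w, Differentiable ℝ (f w))
    (hlip : ∀ w, ∀ x y : EuclideanSpace ℝ (Fin D),
      ‖gradient (f w) x - gradient (f w) y‖ ≤ L * ‖x - y‖)
    (F : EuclideanSpace ℝ (Fin D) → ℝ)
    (hF : F = fun y => (R : ℝ)⁻¹ * ∑ w ∈ Reg, f w y)
    (hhet : ∀ (x : EuclideanSpace ℝ (Fin D)), ∀ w ∈ Reg,
      ‖gradient (f w) x - gradient F x‖ ≤ ξ)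
    (hdist : ∀ (x : EuclideanSpace ℝ (Fin D)), ∀ w ∉ Reg,
      ‖gradient (f w) x - gradient F x‖ ≤ A)
    (E : Matrix (Fin W) (Fin W) ℝ)
    (hEnonneg : ∀ w v, 0 ≤ E w v)
    (hErow : ∀ w, ∑ v, E w v = 1) (hEcol : ∀ v, ∑ w, E w v = 1)
    (J : Matrix (Fin W) (Fin W) ℝ) (hJ : J = Matrix.of fun _ _ => (W : ℝ)⁻¹)
    (lam : ℝ) (hlam : lam = ‖Matrix.toEuclideanCLM (𝕜 := ℝ) (E - J)‖)
    (hlam1 : lam < 1)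
    (hKbig : (K : ℝ) ≥ max (24 * lam ^ 2 * L ^ 2 / (1 - lam) ^ 2) (L ^ 2))
    (γ : ℝ) (hγ : γ = 1 / Real.sqrt K)
    (x0 : EuclideanSpace ℝ (Fin D))
    (xhat : ℕ → Fin W → EuclideanSpace ℝ (Fin D))
    (hinit : ∀ w, xhat 0 w = x0)
    (hstep : ∀ k w, xhat (k + 1) w =
      ∑ v, E w v • (xhat k v - γ • gradient (f v) (xhat k v)))
    (xbar : ℕ → EuclideanSpace ℝ (Fin D))
    (hxbar : ∀ k, xbar k = (R : ℝ)⁻¹ • ∑ w ∈ Reg, xhat k w) :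
    ∀ k ≤ K, ∀ w ∈ Reg, ‖xhat k w - xbar k‖ ^ 2 ≤
      48 * (W : ℝ) * (1 + (W : ℝ) / (R : ℝ)) * lam ^ 2
          * (δ ^ 2 * A ^ 2 + max (ξ ^ 2) (A ^ 2)) / ((K : ℝ) * (1 - lam) ^ 2) := by
  intro k _ w hw
  have hK' : (0 : ℝ) < K := by exact_mod_cast hK
  have hlam0 : 0 ≤ lam := hlam ▸ norm_nonneg _
  have hgap : 0 < 1 - lam := by linarith
  have hγ0 : 0 ≤ γ := by rw [hγ]; positivity
  have hγsq : γ ^ 2 = 1 / K := by rw [hγ, div_pow, Real.sq_sqrt hK'.le, one_pow]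
  set M := max ξ A with hM
  have hM0 : 0 ≤ M := hξ.trans (le_max_left _ _)
  have hMsq : M ^ 2 = max (ξ ^ 2) (A ^ 2) := by
    rcases le_total ξ A with h | h
    · rw [hM, max_eq_right h, max_eq_right (pow_le_pow_left₀ hξ h 2)]
    · rw [hM, max_eq_left h, max_eq_left (pow_le_pow_left₀ hA h 2)]
  have hG : ∀ x v, ‖gradient (f v) x - gradient F x‖ ≤ M := fun x v => by
    by_cases hv : v ∈ Reg
    · exact (hhet x v hv).trans (le_max_left _ _)
    · exact (hdist x v hv).trans (le_max_right _ _)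
  have hsmall : lam * (γ * L) ≤ (1 - lam) / 2 := by
    refine le_of_sq_le_sq ?_ (by positivity)
    have h := (le_max_left _ _).trans hKbig
    rw [div_le_iff₀ (by positivity)] at h
    have h' : (lam * (γ * L)) ^ 2 = lam ^ 2 * L ^ 2 / K := by
      rw [mul_pow, mul_pow, hγsq]; ring
    rw [h', div_le_iff₀ hK']
    nlinarith [mul_nonneg hK'.le (sq_nonneg (1 - lam))]
  set B := 2 * lam * γ * (√W * M) / (1 - lam) with hB
  have hB0 : 0 ≤ B := by positivity
  have hBeq : lam * (γ * (√W * M)) = (1 - lam) / 2 * B := by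
    rw [hB]; field_simp
  have hdev : ∀ k, ‖(WithLp.toLp 2 (fun w => xhat k w - (W : ℝ)⁻¹ • ∑ v, xhat k v) :
      PiLp 2 fun _ : Fin W => EuclideanSpace ℝ (Fin D))‖ ≤ B := by
    intro k
    induction k with
    | zero =>
      have hW' : (W : ℝ) ≠ 0 := by positivity
      have hzero : (fun w => xhat 0 w - (W : ℝ)⁻¹ • ∑ v, xhat 0 v) = 0 := by
        funext w
        simp [hinit, ← Nat.cast_smul_eq_nsmul ℝ, smul_smul, hW']
      rw [hzero]
      simpa using hB0
    | succ k ih =>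
      have h := norm_deviation_gossip_step_le hW L M γ hL.le hM0 hγ0 (fun v => gradient (f v))
        hlip (gradient F) hG E hErow hEcol J hJ (xhat k) (xhat (k + 1)) (hstep k)
      rw [← hlam] at h
      refine h.trans ?_
      have h1 := mul_le_mul_of_nonneg_left ih (by positivity : 0 ≤ lam * (1 + γ * L))
      have h2 := mul_le_mul_of_nonneg_right hsmall hB0
      linarith
  have hx := norm_sub_mean_le Reg (xhat k) ((W : ℝ)⁻¹ • ∑ v, xhat k v) B
    (fun v _ => (PiLp.norm_apply_le (WithLp.toLp 2 fun w => xhat k w - (W : ℝ)⁻¹ • ∑ v, xhat k v)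
      v).trans (hdev k)) hw
  rw [← hR, ← hxbar] at hx
  have hBsq : (2 * B) ^ 2 = 16 * W * lam ^ 2 * M ^ 2 / (K * (1 - lam) ^ 2) := by
    have h : (2 * B) ^ 2 = 16 * √W ^ 2 * lam ^ 2 * M ^ 2 * γ ^ 2 / (1 - lam) ^ 2 := by
      rw [hB, mul_pow, div_pow]; ring
    rw [h, Real.sq_sqrt (Nat.cast_nonneg _), hγsq]
    field_simp
  refine (pow_le_pow_left₀ (norm_nonneg _) hx 2).trans ?_
  rw [hBsq, ← hMsq]
  have hfactor : (16 : ℝ) * W ≤ 48 * W * (1 + W / R) := by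
    have : (0 : ℝ) ≤ W * (W / R) := by positivity
    nlinarith [(Nat.cast_nonneg W : (0 : ℝ) ≤ W)]
  have hterm : M ^ 2 ≤ δ ^ 2 * A ^ 2 + M ^ 2 := le_add_of_nonneg_left (by positivity)
  gcongr
end

section
/- Let D, N, P be integers with N − 2P ≥ 1 and P ≥ 0, let z ∈ ℝ^D, and let y₁, …, y_N ∈ ℝ^D be vectors such that at most P of them differ from z (i.e., |{v : y_v ≠ z}| ≤ P). Then for every coordinate i ∈ {1,…,D}, if π is any permutation of {1,…,N} sorting the i-th coordinates in non-decreasing order, [y_{π(1)}]_i ≤ ⋯ ≤ [y_{π(N)}]_i, the trimmed mean (1/(N−2P))·Σ_{j=P+1}^{N−P} [y_{π(j)}]_i equals [z]_i. Consequently, the coordinate-wise trimmed mean of {y₁,…,y_N} (discarding the P smallest and P largest values in each coordinate and averaging the rest) equals z; that is, TriMean is a majority-dominant aggregator. -/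
open Finset

/-- A monotone sequence with at most `P` terms different from `c` equals `c` at every index that is
at distance at least `P` from both ends. -/
lemma Monotone.eq_of_card_ne_le {α : Type*} [LinearOrder α] {N P : ℕ} {f : Fin N → α}
    (hf : Monotone f) {c : α} (hc : #{j | f j ≠ c} ≤ P) {j : Fin N} (hj : P ≤ (j : ℕ))
    (hj' : (j : ℕ) < N - P) : f j = c := by
  rcases lt_trichotomy (f j) c with h | h | h
  · have hsub : Iic j ⊆ ({j | f j ≠ c} : Finset (Fin N)) := fun k hk => by
      simpa using ((hf (mem_Iic.1 hk)).trans_lt h).ne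
    have hcard := card_le_card hsub
    rw [Fin.card_Iic] at hcard
    omega
  · exact h
  · have hsub : Ici j ⊆ ({j | f j ≠ c} : Finset (Fin N)) := fun k hk => by
      simpa using (h.trans_le (hf (mem_Ici.1 hk))).ne'
    have hcard := card_le_card hsub
    rw [Fin.card_Ici] at hcard
    omega

lemma Fin.card_filter_le_and_lt {N a b : ℕ} (hb : b ≤ N) :
    #{j : Fin N | a ≤ (j : ℕ) ∧ (j : ℕ) < b} = b - a := by
  rw [← Nat.card_Ico, ← card_map Fin.valEmbedding]
  congr 1
  ext k
  simp only [mem_map, mem_filter, mem_univ, true_and, Fin.valEmbedding_apply, mem_Ico]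
  constructor
  · rintro ⟨j, hj, rfl⟩
    exact hj
  · exact fun hk => ⟨⟨k, hk.2.trans_le hb⟩, hk, rfl⟩

/-- TriMean is a majority-dominant aggregator: if at most `P` of the `N` inputs differ from
`z` and `N - 2P ≥ 1`, then in every coordinate the trimmed mean (discarding the `P`
smallest and the `P` largest values and averaging the rest) equals the corresponding
coordinate of `z`. -/
theorem triMean_majority_dominant
    (D N P : ℕ) (hD : 0 < D) (hNP : 2 * P < N)
    (z : EuclideanSpace ℝ (Fin D))
    (y : Fin N → EuclideanSpace ℝ (Fin D))
    (hmaj : {v : Fin N | y v ≠ z}.ncard ≤ P) :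
    ∀ i : Fin D, ∀ π : Equiv.Perm (Fin N),
      (∀ j k : Fin N, j ≤ k → y (π j) i ≤ y (π k) i) →
      ((N : ℝ) - 2 * P)⁻¹ *
          ∑ j ∈ Finset.univ.filter (fun j : Fin N => P ≤ (j : ℕ) ∧ (j : ℕ) < N - P),
            y (π j) i
        = z i := by
  intro i π hπ
  have hcard : #{j | y (π j) i ≠ z i} ≤ P := by
    refine le_trans ?_ hmaj
    rw [← card_map π.toEmbedding, ← Set.ncard_coe_finset]
    refine Set.ncard_le_ncard (fun v hv => ?_) (Set.toFinite _)
    obtain ⟨j, hj, rfl⟩ := mem_map.1 (mem_coe.1 hv)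
    exact fun h => (mem_filter.1 hj).2 (congrArg (fun x => x i) h)
  have hmono : Monotone fun j => y (π j) i := fun j k => hπ j k
  rw [sum_congr rfl fun j hj => hmono.eq_of_card_ne_le hcard (mem_filter.1 hj).2.1
      (mem_filter.1 hj).2.2,
    sum_const, Fin.card_filter_le_and_lt (Nat.sub_le N P), nsmul_eq_mul, ← mul_assoc]
  have hcast : ((N - P - P : ℕ) : ℝ) = (N : ℝ) - 2 * P := by
    rw [Nat.sub_sub, ← two_mul, Nat.cast_sub hNP.le]
    push_cast
    rfl
  have hpos : (0 : ℝ) < (N : ℝ) - 2 * P := sub_pos.2 (by exact_mod_cast hNP)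
  rw [hcast, inv_mul_cancel₀ hpos.ne', one_mul]
end

section
/- Let D be a positive integer, let V be a finite index set with |V| = N, let S ⊆ V with |S| = P and 2P < N, let z ∈ ℝ^D, and let y : V → ℝ^D satisfy y_v = z for all v ∉ S. Let U₀ ⊇ U₁ ⊇ ⋯ ⊇ U_P be subsets of V with U₀ = V and, for each t < P, U_{t+1} = U_t \ {v_t} where v_t is any element of U_t maximizing ‖y_v − (1/|U_t|)·Σ_{u∈U_t} y_u‖ over v ∈ U_t. Then the average of the remaining vectors equals z: (1/(N−P))·Σ_{v∈U_P} y_v = z. In particular, the FABA aggregator (which iteratively removes the input farthest from the current average P times and outputs the average of the remaining inputs) is a majority-dominant aggregator. -/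
open Finset

/-- If a strict majority of the vectors `y v`, `v ∈ T`, equal `z`, and `z` is at maximal distance
from their average, then all of them equal `z`. -/
theorem eq_of_majority_of_farthest {V E : Type*} [NormedAddCommGroup E] [NormedSpace ℝ E]
    [DecidableEq E] (T : Finset V) (y : V → E) (z : E)
    (hmaj : 2 * (T.filter (fun v => y v ≠ z)).card < T.card)
    (hfar : ∀ v ∈ T, ‖y v - (T.card : ℝ)⁻¹ • ∑ u ∈ T, y u‖ ≤
      ‖z - (T.card : ℝ)⁻¹ • ∑ u ∈ T, y u‖) :
    ∀ v ∈ T, y v = z := by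
  set m := (T.card : ℝ)⁻¹ • ∑ u ∈ T, y u with hm
  have hcard : (0 : ℝ) < T.card := by exact_mod_cast (Nat.zero_le _).trans_lt hmaj
  have hdist : ∀ v ∈ T, ‖y v - z‖ ≤ 2 * ‖z - m‖ := fun v hv => by
    have htri := norm_sub_le (y v - m) (z - m)
    rw [sub_sub_sub_cancel_right] at htri
    linarith [hfar v hv]
  have hsum : (T.card : ℝ) • (m - z) = ∑ v ∈ T with y v ≠ z, (y v - z) := by
    rw [Finset.sum_filter_of_ne (fun v _ h => sub_ne_zero.mp h), Finset.sum_sub_distrib,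
      Finset.sum_const, smul_sub, hm, smul_inv_smul₀ hcard.ne', Nat.cast_smul_eq_nsmul]
  have hbound : (T.card : ℝ) * ‖z - m‖ ≤
      (T.filter (fun v => y v ≠ z)).card * (2 * ‖z - m‖) := by
    calc (T.card : ℝ) * ‖z - m‖ = ‖(T.card : ℝ) • (m - z)‖ := by
          rw [norm_smul, Real.norm_natCast, norm_sub_rev]
      _ ≤ ∑ v ∈ T with y v ≠ z, ‖y v - z‖ := hsum ▸ norm_sum_le _ _
      _ ≤ (T.filter (fun v => y v ≠ z)).card * (2 * ‖z - m‖) := by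
          rw [← nsmul_eq_mul]
          exact Finset.sum_le_card_nsmul _ _ _ fun v hv => hdist v (Finset.mem_filter.mp hv).1
  have hmaj' : 2 * ((T.filter (fun v => y v ≠ z)).card : ℝ) < T.card := by exact_mod_cast hmaj
  have hzero : ‖z - m‖ ≤ 0 := by
    by_contra! hpos
    nlinarith [mul_lt_mul_of_pos_right hmaj' hpos]
  intro v hv
  exact sub_eq_zero.mp (norm_le_zero_iff.mp ((hdist v hv).trans (by linarith)))

/-- FABA is a majority-dominant aggregator: if the inputs outside the poisoned set `S`
(with `|S| = P` and `2P < N`) all equal `z`, and one iteratively removes, `P` times, an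
input farthest from the average of the currently remaining inputs, then the average of the
remaining inputs equals `z`. -/
theorem faba_majority_dominant
    (D : ℕ) (hD : 0 < D)
    (V : Type) [Fintype V] [DecidableEq V]
    (N P : ℕ) (hN : N = Fintype.card V)
    (S : Finset V) (hS : S.card = P) (hNP : 2 * P < N)
    (z : EuclideanSpace ℝ (Fin D))
    (y : V → EuclideanSpace ℝ (Fin D))
    (hy : ∀ v ∉ S, y v = z)
    (U : ℕ → Finset V)
    (hU0 : U 0 = Finset.univ)
    (hUstep : ∀ t < P, ∃ vt ∈ U t,
      (∀ v ∈ U t,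
        ‖y v - ((U t).card : ℝ)⁻¹ • ∑ u ∈ U t, y u‖ ≤
        ‖y vt - ((U t).card : ℝ)⁻¹ • ∑ u ∈ U t, y u‖) ∧
      U (t + 1) = (U t).erase vt) :
    ((N - P : ℕ) : ℝ)⁻¹ • ∑ v ∈ U P, y v = z := by
  classical
  have hinv : ∀ t ≤ P, (U t).card + t = N ∧
      ((U t).filter (fun v => y v ≠ z)).card ≤ P - t := by
    intro t
    induction t with
    | zero =>
      intro _
      refine ⟨by rw [hU0, Finset.card_univ, hN, add_zero], ?_⟩
      rw [Nat.sub_zero, ← hS]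
      refine Finset.card_le_card fun v hv => ?_
      by_contra hvS
      exact (Finset.mem_filter.mp hv).2 (hy v hvS)
    | succ t ih =>
      intro ht
      obtain ⟨hcard, hpoison⟩ := ih (by omega)
      obtain ⟨w, hw, hfar, hstep⟩ := hUstep t (by omega)
      have hpos : 0 < (U t).card := Finset.card_pos.mpr ⟨w, hw⟩
      rw [hstep]
      refine ⟨by rw [Finset.card_erase_of_mem hw]; omega, ?_⟩
      rw [Finset.filter_erase]
      by_cases hwz : y w = z
      · have hall := eq_of_majority_of_farthest (U t) y z (by omega) (hwz ▸ hfar)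
        rw [Finset.filter_false_of_mem fun v hv => not_not.mpr (hall v hv)]
        simp
      · rw [Finset.card_erase_of_mem (Finset.mem_filter.mpr ⟨hw, hwz⟩)]
        omega
  obtain ⟨hcard, hpoison⟩ := hinv P le_rfl
  rw [Nat.sub_self, Nat.le_zero, Finset.card_eq_zero, Finset.filter_eq_empty_iff] at hpoison
  rw [Finset.sum_congr rfl fun v hv => not_not.mp (hpoison hv), Finset.sum_const,
    show (U P).card = N - P by omega, ← Nat.cast_smul_eq_nsmul ℝ, inv_smul_smul₀]
  exact Nat.cast_ne_zero.mpr (by omega)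
end

section
/- Let D be a positive integer, let V be a finite index set with |V| = N, let S ⊆ V, let e : V → ℝ satisfy e_v > 0 for all v and Σ_{v∈V} e_v = 1 with Σ_{v∈S} e_v < 1/2, let z ∈ ℝ^D, and let y : V → ℝ^D satisfy y_v = z for all v ∉ S. Let P = |S| and let U₀ ⊇ U₁ ⊇ ⋯ ⊇ U_P be subsets of V with U₀ = V and, for each t < P, U_{t+1} = U_t \ {v_t} where v_t is any element of U_t maximizing ‖y_v − (Σ_{u∈U_t} e_u y_u)/(Σ_{u∈U_t} e_u)‖ over v ∈ U_t. Then the weighted average of the remaining vectors equals z: (Σ_{v∈U_P} e_v y_v)/(Σ_{v∈U_P} e_v) = z. In particular, the IOS aggregator is majority-dominant whenever the total mixing weight of the poisoned inputs is less than 1/2. -/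
open Finset

/-- The weighted deviations from the weighted average sum to zero. -/
lemma sum_smul_sub_weighted_average {V E : Type*} [AddCommGroup E] [Module ℝ E]
    (U : Finset V) (e : V → ℝ) (y : V → E) (hne : ∑ u ∈ U, e u ≠ 0) :
    ∑ v ∈ U, e v • (y v - (∑ u ∈ U, e u)⁻¹ • ∑ u ∈ U, e u • y u) = 0 := by
  simp only [smul_sub, sum_sub_distrib]
  rw [← sum_smul, smul_inv_smul₀ hne, sub_self]

/-- If inputs equal to `z` carry a strict majority of the weight and no input is farther than `z`
from the weighted average, then all inputs equal `z`. -/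
lemma eq_of_majority_farthest {V E : Type*} [DecidableEq V]
    [NormedAddCommGroup E] [NormedSpace ℝ E]
    (U S : Finset V) (e : V → ℝ) (he : ∀ v, 0 < e v) (y : V → E) (z : E)
    (hy : ∀ v ∉ S, y v = z)
    (hmaj : ∑ v ∈ U ∩ S, e v < ∑ v ∈ U \ S, e v)
    (hfar : ∀ v ∈ U, ‖y v - (∑ u ∈ U, e u)⁻¹ • ∑ u ∈ U, e u • y u‖ ≤
      ‖z - (∑ u ∈ U, e u)⁻¹ • ∑ u ∈ U, e u • y u‖) :
    ∀ v ∈ U, y v = z := by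
  have hsplit := sum_inter_add_sum_sdiff U S e
  have hbad : 0 ≤ ∑ v ∈ U ∩ S, e v := sum_nonneg fun v _ => (he v).le
  have hdev := sum_smul_sub_weighted_average U e y (by linarith)
  set a := (∑ u ∈ U, e u)⁻¹ • ∑ u ∈ U, e u • y u
  have hgood : ∑ v ∈ U \ S, e v • (y v - a) = (∑ v ∈ U \ S, e v) • (z - a) := by
    rw [sum_smul]
    exact sum_congr rfl fun v hv => by rw [hy v (mem_sdiff.1 hv).2]
  rw [← sum_inter_add_sum_sdiff U S, hgood] at hdev
  have hnorm : (∑ v ∈ U \ S, e v) * ‖z - a‖ ≤ (∑ v ∈ U ∩ S, e v) * ‖z - a‖ := by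
    calc (∑ v ∈ U \ S, e v) * ‖z - a‖ = ‖(∑ v ∈ U \ S, e v) • (z - a)‖ := by
          rw [norm_smul, Real.norm_of_nonneg (by linarith)]
      _ = ‖∑ v ∈ U ∩ S, e v • (y v - a)‖ := by
          rw [eq_neg_of_add_eq_zero_right hdev, norm_neg]
      _ ≤ ∑ v ∈ U ∩ S, e v * ‖z - a‖ := by
          refine norm_sum_le_of_le _ fun v hv => ?_
          rw [norm_smul, Real.norm_of_nonneg (he v).le]
          exact mul_le_mul_of_nonneg_left (hfar v (mem_inter.1 hv).1) (he v).le
      _ = (∑ v ∈ U ∩ S, e v) * ‖z - a‖ := by rw [sum_mul]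
  have hza : ‖z - a‖ = 0 := by
    nlinarith [norm_nonneg (z - a)]
  intro v hv
  have hva : ‖y v - a‖ = 0 := le_antisymm (hza ▸ hfar v hv) (norm_nonneg _)
  rw [sub_eq_zero.1 (norm_eq_zero.1 hva), sub_eq_zero.1 (norm_eq_zero.1 hza)]

/-- IOS is a majority-dominant aggregator whenever the total mixing weight of the poisoned
inputs is less than `1/2`: if the inputs outside the poisoned set `S` all equal `z` and one
iteratively removes, `|S|` times, an input farthest from the weighted average of the
currently remaining inputs, then the weighted average of the remaining inputs equals `z`. -/
theorem ios_majority_dominant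
    (D : ℕ) (hD : 0 < D)
    (V : Type) [Fintype V] [DecidableEq V]
    (N : ℕ) (hN : N = Fintype.card V)
    (S : Finset V)
    (e : V → ℝ) (he : ∀ v, 0 < e v) (hsum : ∑ v, e v = 1)
    (hShalf : ∑ v ∈ S, e v < 1 / 2)
    (z : EuclideanSpace ℝ (Fin D))
    (y : V → EuclideanSpace ℝ (Fin D))
    (hy : ∀ v ∉ S, y v = z)
    (P : ℕ) (hP : P = S.card)
    (U : ℕ → Finset V)
    (hU0 : U 0 = Finset.univ)
    (hUstep : ∀ t < P, ∃ vt ∈ U t,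
      (∀ v ∈ U t,
        ‖y v - (∑ u ∈ U t, e u)⁻¹ • ∑ u ∈ U t, e u • y u‖ ≤
        ‖y vt - (∑ u ∈ U t, e u)⁻¹ • ∑ u ∈ U t, e u • y u‖) ∧
      U (t + 1) = (U t).erase vt) :
    (∑ v ∈ U P, e v)⁻¹ • ∑ v ∈ U P, e v • y v = z := by
  have hcompl : ∑ v ∈ S, e v + ∑ v ∈ Sᶜ, e v = 1 := by rw [sum_add_sum_compl, hsum]
  have inv : ∀ t ≤ P, #(U t) + t = Fintype.card V ∧ ((∀ v ∈ U t, y v = z) ∨ Sᶜ ⊆ U t) := by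
    intro t
    induction t with
    | zero => simp [hU0]
    | succ t ih =>
      intro ht
      obtain ⟨hcard, h⟩ := ih (by omega)
      obtain ⟨w, hw, hmax, hstep⟩ := hUstep t (by omega)
      rw [hstep]
      refine ⟨by have := card_erase_add_one hw; omega, ?_⟩
      rcases h with h | h
      · exact Or.inl fun v hv => h v (mem_of_mem_erase hv)
      by_cases hwS : w ∈ S
      · exact Or.inr (subset_erase.2 ⟨h, by simpa using hwS⟩)
      rw [hy w hwS] at hmax
      refine Or.inl fun v hv =>
        eq_of_majority_farthest (U t) S e he y z hy ?_ hmax v (mem_of_mem_erase hv)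
      have hbad : ∑ v ∈ U t ∩ S, e v ≤ ∑ v ∈ S, e v :=
        sum_le_sum_of_subset_of_nonneg inter_subset_right fun v _ _ => (he v).le
      have hgood : ∑ v ∈ Sᶜ, e v ≤ ∑ v ∈ U t \ S, e v :=
        sum_le_sum_of_subset_of_nonneg
          (fun v hv => mem_sdiff.2 ⟨h hv, mem_compl.1 hv⟩) fun v _ _ => (he v).le
      linarith
  obtain ⟨hcard, h⟩ := inv P le_rfl
  have hcardS := card_add_card_compl S
  have hall : ∀ v ∈ U P, y v = z := by
    rcases h with h | h
    · exact h
    · have hUP : Sᶜ = U P := eq_of_subset_of_card_le h (by omega)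
      exact fun v hv => hy v (mem_compl.1 (hUP ▸ hv))
  have hne : (U P).Nonempty := by
    have hSne : (Sᶜ).Nonempty := by
      rw [nonempty_iff_ne_empty]
      intro h0
      rw [h0, sum_empty] at hcompl
      linarith
    have := hSne.card_pos
    exact card_pos.1 (by omega)
  have hpos : 0 < ∑ v ∈ U P, e v := sum_pos (fun v _ => he v) hne
  have hconst : ∑ v ∈ U P, e v • y v = ∑ v ∈ U P, e v • z :=
    sum_congr rfl fun v hv => by rw [hall v hv]
  rw [hconst, ← sum_smul, inv_smul_smul₀ hpos.ne']
end

section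
/- Let D be a positive integer, z, a ∈ ℝ^D with a ≠ z, τ > 0, and integers H > P ≥ 1 with N = H + P. Consider the input family consisting of H copies of z and P copies of a. Then the one-step centered clipping update with starting point s⁰ = z, namely s¹ = s⁰ + (1/N)·Σ_{inputs y} CLIP(y − s⁰, τ), equals z + (P/N)·CLIP(a − z, τ), and s¹ ≠ z. Consequently, one-step centered clipping (CC) with starting point equal to the agent's own model and any positive clipping threshold is not a majority-dominant aggregator. -/
open Finset

/-- One-step centered clipping (CC) with starting point equal to the common regular vector
`z` and any positive clipping threshold: on the input family consisting of `H` copies of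
`z` and `P` copies of `a ≠ z` (with `H > P ≥ 1`), the one-step CC update equals
`z + (P/N) • CLIP(a − z, τ)` and differs from `z`; hence CC is not majority-dominant. -/
theorem cc_not_majority_dominant
    (D : ℕ) (hD : 0 < D)
    (z a : EuclideanSpace ℝ (Fin D)) (haz : a ≠ z)
    (τ : ℝ) (hτ : 0 < τ)
    (H P N : ℕ) (hHP : P < H) (hP : 1 ≤ P) (hN : N = H + P)
    (clip : EuclideanSpace ℝ (Fin D) → EuclideanSpace ℝ (Fin D))
    (hclip : ∀ u, clip u = if ‖u‖ ≤ τ then u else (τ / ‖u‖) • u)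
    (y : Fin N → EuclideanSpace ℝ (Fin D))
    (hy : ∀ v : Fin N, y v = if (v : ℕ) < H then z else a)
    (s1 : EuclideanSpace ℝ (Fin D))
    (hs1 : s1 = z + (N : ℝ)⁻¹ • ∑ v, clip (y v - z)) :
    s1 = z + ((P : ℝ) / (N : ℝ)) • clip (a - z) ∧ s1 ≠ z := by
  subst hN
  have hclip_zero : clip 0 = 0 := by simp [hclip]
  have hclip_ne : clip (a - z) ≠ 0 := by
    have hne : a - z ≠ 0 := sub_ne_zero.mpr haz
    rw [hclip]
    split_ifs
    · exact hne
    · exact smul_ne_zero (div_ne_zero hτ.ne' (norm_ne_zero_iff.mpr hne)) hne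
  have hsum : ∑ v, clip (y v - z) = (P : ℝ) • clip (a - z) := by
    rw [Fin.sum_univ_add]
    simp [hy, hclip_zero, Nat.cast_smul_eq_nsmul]
  have hs : s1 = z + ((P : ℝ) / ((H + P : ℕ) : ℝ)) • clip (a - z) := by
    rw [hs1, hsum, smul_smul, div_eq_inv_mul]
  refine ⟨hs, ?_⟩
  rw [hs, Ne, add_eq_left]
  have hP0 : (P : ℝ) ≠ 0 := by exact_mod_cast (by lia : P ≠ 0)
  have hN0 : ((H + P : ℕ) : ℝ) ≠ 0 := by exact_mod_cast (by lia : H + P ≠ 0)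
  exact smul_ne_zero (div_ne_zero hP0 hN0) hclip_ne
end

section
/- Let D be a positive integer, z, a ∈ ℝ^D with a ≠ z, and τ > 0. Let V be a finite index set, S ⊆ V, and let e : V → ℝ be nonnegative weights with Σ_{v∈S} e_v > 0. Consider inputs y : V → ℝ^D with y_v = z for v ∉ S and y_v = a for v ∈ S. Then the clipped gossip output from the local model z, namely z + Σ_{v∈V} e_v·CLIP(y_v − z, τ), equals z + (Σ_{v∈S} e_v)·CLIP(a − z, τ), and this output differs from z. Consequently, clipped gossip (CG) with any positive clipping threshold is not a majority-dominant aggregator. -/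
open Finset

/-- Clipped gossip (CG) with any positive clipping threshold: if the inputs indexed by the
poisoned set `S` (with positive total mixing weight) all equal `a ≠ z` and the remaining
inputs equal the local model `z`, then the CG output from `z` equals
`z + (Σ_{v∈S} e_v) • CLIP(a − z, τ)` and differs from `z`; hence CG is not
majority-dominant. -/
theorem cg_not_majority_dominant
    (D : ℕ) (hD : 0 < D)
    (z a : EuclideanSpace ℝ (Fin D)) (haz : a ≠ z)
    (τ : ℝ) (hτ : 0 < τ)
    (V : Type) [Fintype V] [DecidableEq V]
    (S : Finset V)
    (e : V → ℝ) (he : ∀ v, 0 ≤ e v) (heS : 0 < ∑ v ∈ S, e v)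
    (clip : EuclideanSpace ℝ (Fin D) → EuclideanSpace ℝ (Fin D))
    (hclip : ∀ u, clip u = if ‖u‖ ≤ τ then u else (τ / ‖u‖) • u)
    (y : V → EuclideanSpace ℝ (Fin D))
    (hyR : ∀ v ∉ S, y v = z) (hyP : ∀ v ∈ S, y v = a) :
    z + ∑ v, e v • clip (y v - z) = z + (∑ v ∈ S, e v) • clip (a - z) ∧
    z + ∑ v, e v • clip (y v - z) ≠ z := by
  have hsum : ∑ v, e v • clip (y v - z) = (∑ v ∈ S, e v) • clip (a - z) := by
    have hzero : clip 0 = 0 := by simp [hclip]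
    rw [Finset.sum_smul, ← Finset.sum_subset (Finset.subset_univ S)]
    · exact Finset.sum_congr rfl fun v hv => by rw [hyP v hv]
    · intro v _ hv
      rw [hyR v hv, sub_self, hzero, smul_zero]
  have hne : clip (a - z) ≠ 0 := by
    have hsub : a - z ≠ 0 := sub_ne_zero.mpr haz
    rw [hclip]
    split_ifs
    · exact hsub
    · exact smul_ne_zero (div_ne_zero hτ.ne' (norm_ne_zero_iff.mpr hsub)) hsub
  rw [hsum]
  exact ⟨rfl, fun h => smul_ne_zero heS.ne' hne (add_eq_left.mp h)⟩
end

section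
/- Let D, W be positive integers, let 𝓡 ⊆ {1,…,W} be nonempty with |𝓡| = R, let L > 0, ξ ≥ 0, A ≥ 0, and set δ = 1 − R/W. For each w ∈ {1,…,W} let f̂_w : ℝ^D → ℝ be differentiable with L-Lipschitz gradient, set f = (1/R)·Σ_{w∈𝓡} f̂_w, and assume that for all x: ‖∇f̂_w(x) − ∇f(x)‖ ≤ ξ for every w ∈ 𝓡 and ‖∇f̂_w(x) − ∇f(x)‖ ≤ A for every w ∉ 𝓡. Then for any vectors x̂₁, …, x̂_W ∈ ℝ^D with average x̄ = (1/W)·Σ_{w} x̂_w, Σ_{w=1}^W ‖∇f̂_w(x̂_w) − (1/W)·Σ_{v=1}^W ∇f̂_v(x̂_v)‖² ≤ 6L²·Σ_{w=1}^W ‖x̂_w − x̄‖² + 6W·(δ²A² + max{ξ², A²}). -/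
open Finset

/-- The arithmetic mean of a finite family minimizes the sum of squared distances. -/
theorem sum_norm_sub_mean_sq_le {ι E : Type*} [Fintype ι] [Nonempty ι]
    [NormedAddCommGroup E] [InnerProductSpace ℝ E] (g : ι → E) (c : E) :
    ∑ i, ‖g i - (Fintype.card ι : ℝ)⁻¹ • ∑ j, g j‖ ^ 2 ≤ ∑ i, ‖g i - c‖ ^ 2 := by
  set m := (Fintype.card ι : ℝ)⁻¹ • ∑ j, g j with hm
  have hsum : ∑ i, (g i - m) = 0 := by
    have hcard : (Fintype.card ι : ℝ) ≠ 0 := Nat.cast_ne_zero.mpr Fintype.card_ne_zero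
    rw [sum_sub_distrib, sum_const, card_univ, ← Nat.cast_smul_eq_nsmul ℝ, hm,
      smul_inv_smul₀ hcard, sub_self]
  have hinner : ∑ i, inner ℝ (g i - m) (m - c) = 0 := by
    rw [← sum_inner, hsum, inner_zero_left]
  have hexpand : ∀ i, ‖g i - c‖ ^ 2 =
      ‖g i - m‖ ^ 2 + 2 * inner ℝ (g i - m) (m - c) + ‖m - c‖ ^ 2 := fun i => by
    rw [← norm_add_sq_real, sub_add_sub_cancel]
  simp only [hexpand, sum_add_distrib, ← mul_sum, hinner, mul_zero, add_zero]
  exact le_add_of_nonneg_right (sum_nonneg fun _ _ => sq_nonneg _)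

/-- Bound on the total deviation of the local gradients (evaluated at the local models)
from their network average, in terms of the consensus error, the global contamination rate
`δ`, the heterogeneity bound `ξ` and the disturbance bound `A`. -/
theorem gradient_deviation_bound
    (D W : ℕ) (hD : 0 < D) (hW : 0 < W)
    (Reg : Finset (Fin W)) (hReg : Reg.Nonempty)
    (R : ℕ) (hR : R = Reg.card)
    (L ξ A δ : ℝ) (hL : 0 < L) (hξ : 0 ≤ ξ) (hA : 0 ≤ A)
    (hδ : δ = 1 - (R : ℝ) / (W : ℝ))
    (f : Fin W → EuclideanSpace ℝ (Fin D) → ℝ)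
    (hdiff : ∀ w, Differentiable ℝ (f w))
    (hlip : ∀ w, ∀ x y : EuclideanSpace ℝ (Fin D),
      ‖gradient (f w) x - gradient (f w) y‖ ≤ L * ‖x - y‖)
    (F : EuclideanSpace ℝ (Fin D) → ℝ)
    (hF : F = fun y => (R : ℝ)⁻¹ * ∑ w ∈ Reg, f w y)
    (hhet : ∀ (x : EuclideanSpace ℝ (Fin D)), ∀ w ∈ Reg,
      ‖gradient (f w) x - gradient F x‖ ≤ ξ)
    (hdist : ∀ (x : EuclideanSpace ℝ (Fin D)), ∀ w ∉ Reg,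
      ‖gradient (f w) x - gradient F x‖ ≤ A)
    (xhat : Fin W → EuclideanSpace ℝ (Fin D))
    (xbar : EuclideanSpace ℝ (Fin D))
    (hxbar : xbar = (W : ℝ)⁻¹ • ∑ w, xhat w) :
    ∑ w, ‖gradient (f w) (xhat w) - (W : ℝ)⁻¹ • ∑ v, gradient (f v) (xhat v)‖ ^ 2 ≤
      6 * L ^ 2 * ∑ w, ‖xhat w - xbar‖ ^ 2
      + 6 * (W : ℝ) * (δ ^ 2 * A ^ 2 + max (ξ ^ 2) (A ^ 2)) := by
  have : Nonempty (Fin W) := ⟨⟨0, hW⟩⟩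
  have hmean := sum_norm_sub_mean_sq_le (fun w => gradient (f w) (xhat w)) (gradient F xbar)
  rw [Fintype.card_fin] at hmean
  set M := max (ξ ^ 2) (A ^ 2) with hM
  have hbar : ∀ w, ‖gradient (f w) xbar - gradient F xbar‖ ^ 2 ≤ M := fun w => by
    by_cases hw : w ∈ Reg
    · exact (pow_le_pow_left₀ (norm_nonneg _) (hhet xbar w hw) 2).trans (le_max_left _ _)
    · exact (pow_le_pow_left₀ (norm_nonneg _) (hdist xbar w hw) 2).trans (le_max_right _ _)
  have hlocal : ∀ w, ‖gradient (f w) (xhat w) - gradient F xbar‖ ^ 2 ≤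
      2 * L ^ 2 * ‖xhat w - xbar‖ ^ 2 + 2 * M := fun w => by
    have htri := norm_sub_le_norm_sub_add_norm_sub
      (gradient (f w) (xhat w)) (gradient (f w) xbar) (gradient F xbar)
    have hsq := (pow_le_pow_left₀ (norm_nonneg _) htri 2).trans add_sq_le
    have hlipsq := pow_le_pow_left₀ (norm_nonneg _) (hlip w (xhat w) xbar) 2
    rw [mul_pow] at hlipsq
    linarith [hbar w]
  have hM0 : 0 ≤ M := (sq_nonneg ξ).trans (le_max_left _ _)
  have hsum := sum_le_sum fun w (_ : w ∈ univ) => hlocal w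
  rw [sum_add_distrib, ← mul_sum, sum_const, card_univ, Fintype.card_fin, nsmul_eq_mul] at hsum
  have hcons : 0 ≤ L ^ 2 * ∑ w, ‖xhat w - xbar‖ ^ 2 := by positivity
  have hWM : 0 ≤ (W : ℝ) * M := by positivity
  have hWA : 0 ≤ (W : ℝ) * (δ ^ 2 * A ^ 2) := by positivity
  linarith
end

section
/- Let D, R be positive integers, L > 0, ξ ≥ 0, γ > 0, and for each w ∈ {1,…,R} let f_w : ℝ^D → ℝ be differentiable with L-Lipschitz gradient. Set f = (1/R)·Σ_{w=1}^R f_w and assume ‖∇f_w(x) − ∇f(x)‖ ≤ ξ for all x and all w. Let p ∈ ℝ^R be a probability vector, let x₁, …, x_R ∈ ℝ^D with x̃ = Σ_v p_v x_v, and define the gradient steps x_w^{+} = x_w − γ∇f_w(x_w) and x̃^{+} = Σ_v p_v x_v^{+}. Then for every w, ‖x_w^{+} − x̃^{+}‖ ≤ (1 + 2γL)·max_{v∈{1,…,R}} ‖x_v − x̃‖ + 2γξ. -/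
open Finset

/-- A convex combination of vectors of norm at most `B` has norm at most `B`. -/
theorem norm_sum_smul_le_of_forall_norm_le {ι E : Type*} [Fintype ι]
    [SeminormedAddCommGroup E] [NormedSpace ℝ E] {p : ι → ℝ} (hp0 : ∀ i, 0 ≤ p i)
    (hp1 : ∑ i, p i = 1) {e : ι → E} {B : ℝ} (he : ∀ i, ‖e i‖ ≤ B) :
    ‖∑ i, p i • e i‖ ≤ B := by
  calc ‖∑ i, p i • e i‖ ≤ ∑ i, p i * B := norm_sum_le_of_le _ fun i _ => by
        rw [norm_smul, Real.norm_of_nonneg (hp0 i)]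
        exact mul_le_mul_of_nonneg_left (he i) (hp0 i)
    _ = B := by rw [← Finset.sum_mul, hp1, one_mul]

/-- One local gradient step grows the deviation from the Perron-weighted centroid by at
most a factor `1 + 2γL` plus an additive term `2γξ`. -/
theorem gradient_step_centroid_deviation
    (D R : ℕ) (hD : 0 < D) (hR : 0 < R)
    (L ξ γ : ℝ) (hL : 0 < L) (hξ : 0 ≤ ξ) (hγ : 0 < γ)
    (f : Fin R → EuclideanSpace ℝ (Fin D) → ℝ)
    (hdiff : ∀ w, Differentiable ℝ (f w))
    (hlip : ∀ w, ∀ x y : EuclideanSpace ℝ (Fin D),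
      ‖gradient (f w) x - gradient (f w) y‖ ≤ L * ‖x - y‖)
    (F : EuclideanSpace ℝ (Fin D) → ℝ)
    (hF : F = fun y => (R : ℝ)⁻¹ * ∑ w, f w y)
    (hhet : ∀ (x : EuclideanSpace ℝ (Fin D)) (w : Fin R),
      ‖gradient (f w) x - gradient F x‖ ≤ ξ)
    (p : Fin R → ℝ) (hp0 : ∀ w, 0 ≤ p w) (hp1 : ∑ w, p w = 1)
    (mx : (Fin R → ℝ) → ℝ)
    (hmx : ∀ g : Fin R → ℝ, IsGreatest (Set.range g) (mx g))
    (x : Fin R → EuclideanSpace ℝ (Fin D))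
    (xt : EuclideanSpace ℝ (Fin D)) (hxt : xt = ∑ v, p v • x v)
    (xp : Fin R → EuclideanSpace ℝ (Fin D))
    (hxp : ∀ w, xp w = x w - γ • gradient (f w) (x w))
    (xtp : EuclideanSpace ℝ (Fin D)) (hxtp : xtp = ∑ v, p v • xp v) :
    ∀ w, ‖xp w - xtp‖ ≤
      (1 + 2 * γ * L) * mx (fun v => ‖x v - xt‖) + 2 * γ * ξ := by
  intro w
  set M := mx (fun v => ‖x v - xt‖)
  have hM : ∀ v, ‖x v - xt‖ ≤ M := fun v => (hmx fun v => ‖x v - xt‖).2 ⟨v, rfl⟩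
  -- deviations of the local gradients from the global gradient at the centroid
  let e : Fin R → EuclideanSpace ℝ (Fin D) := fun v => gradient (f v) (x v) - gradient F xt
  have he : ∀ v, ‖e v‖ ≤ L * M + ξ := fun v =>
    calc ‖e v‖ ≤ ‖gradient (f v) (x v) - gradient (f v) xt‖
          + ‖gradient (f v) xt - gradient F xt‖ := norm_sub_le_norm_sub_add_norm_sub _ _ _
      _ ≤ L * M + ξ := add_le_add
          ((hlip v _ _).trans (mul_le_mul_of_nonneg_left (hM v) hL.le)) (hhet xt v)
  have hstep : ∀ v, xp v = x v - γ • e v - γ • gradient F xt := fun v => by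
    rw [hxp, smul_sub]; abel
  have hcentroid : xtp = xt - γ • ∑ v, p v • e v - γ • gradient F xt := by
    simp only [hxtp, hstep, smul_sub, Finset.sum_sub_distrib, ← Finset.sum_smul, hp1, one_smul,
      ← hxt, Finset.smul_sum, smul_comm γ]
  have hdecomp : xp w - xtp = (x w - xt) - γ • (e w - ∑ v, p v • e v) := by
    rw [hstep, hcentroid, smul_sub γ (e w)]; abel
  have hdev : ‖e w - ∑ v, p v • e v‖ ≤ (L * M + ξ) + (L * M + ξ) :=
    norm_sub_le_of_le (he w) (norm_sum_smul_le_of_forall_norm_le hp0 hp1 he)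
  calc ‖xp w - xtp‖ ≤ M + γ * ((L * M + ξ) + (L * M + ξ)) := by
        rw [hdecomp]
        refine norm_sub_le_of_le (hM w) ?_
        rw [norm_smul, Real.norm_of_nonneg hγ.le]
        exact mul_le_mul_of_nonneg_left hdev hγ.le
    _ = (1 + 2 * γ * L) * M + 2 * γ * ξ := by ring
end
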